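/- Let r ≥ 0 be an integer, let k_0 =: q, k_1, …, k_r be positive integers, and let x_0, x_1, …, x_r be roots of unity with (k_0, x_0) ≠ (1,1), (k_r, x_r) ≠ (1,1) and X := x_0 x_1 ⋯ x_r ≠ 1. Then X^{−1} · t_{k_0,…,k_r}(x_0,…,x_r) + Σ_{j=0}^{r} (−1)^{k_0+⋯+k_j} (x_{j+1}⋯x_r)^{−1} t_{k_{j+1},…,k_r}(x_{j+1},…,x_r) · t_{k_j,k_{j−1},…,k_0}(x_j^{−1},…,x_0^{−1}) + Σ_{j=0}^{q−1} Σ_{m_1+⋯+m_r=q−1−j, all m_l ≥ 0} B_{q−1−j}(k; m) · that_{j+1}(X) · Li_{k_1+m_1,…,k_r+m_r}(x_1,…,x_r) + Σ_{j=1}^{r} Σ_{i ≥ 0, m ≥ 0, i+m ≤ k_j−1} Σ_{(m_l)_{l≠j} nonnegative with Σ_{l≠j} m_l = m, and m_j := 0} (−1)^{k_0+⋯+k_{j−1}+m_{j+1}+⋯+m_r} C(q+k_j−m−i−2, q−1) (Π_{l≠j} C(m_l+k_l−1, k_l−1)) · that_{i+1}(X) · Li_{k_{j+1}+m_{j+1},…,k_r+m_r}(x_{j+1},…,x_r)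 · Li_{k_{j−1}+m_{j−1},…,k_1+m_1, q+k_j−i−m−1}(x_{j−1}^{−1},…,x_1^{−1}, x_0^{−1}) = 0. -/

import Mathlib

open Filter Finset

/-- A complex number is a root of unity if some positive power of it equals 1. -/
def IsRootOfUnity (z : ℂ) : Prop := ∃ N : ℕ, 0 < N ∧ z ^ N = 1

open scoped Classical in
/-- Partial sum `Σ_{0<n_1<⋯<n_r≤N} Π_j x_j^{n_j} (n_j + b_j − 1)^{−k_j}` where the list `K`
consists of the triples `(k_j, x_j, b_j)`. -/
noncomputable def cmhzP (K : List (ℕ × ℂ × ℂ)) (N : ℕ) : ℂ :=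
  ∑ n ∈ Finset.univ.filter (fun n : Fin K.length → Fin N => StrictMono n),
    ∏ j : Fin K.length,
      (K.get j).2.1 ^ ((n j : ℕ) + 1) /
        ((((n j : ℕ) + 1 : ℕ) : ℂ) + (K.get j).2.2 - 1) ^ (K.get j).1

/-- Cyclotomic multiple Hurwitz zeta value: the limit of the partial sums `cmhzP`. -/
noncomputable def cmhz (K : List (ℕ × ℂ × ℂ)) : ℂ := limUnder atTop (cmhzP K)

/-- Cyclotomic multiple zeta value (all Hurwitz parameters equal to 1). -/
noncomputable def cmzv (K : List (ℕ × ℂ)) : ℂ := cmhz (K.map fun p => (p.1, p.2, 1))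

/-- Cyclotomic multiple t-value (all Hurwitz parameters equal to 1/2). -/
noncomputable def tval (K : List (ℕ × ℂ)) : ℂ := cmhz (K.map fun p => (p.1, p.2, (1 : ℂ)/2))

/-- Depth-one cyclotomic zeta value `Li_k(x)`. -/
noncomputable def li1 (k : ℕ) (x : ℂ) : ℂ := cmzv [(k, x)]

/-- Depth-one cyclotomic Hurwitz zeta value `Li_k(x; b)`. -/
noncomputable def lih1 (k : ℕ) (x b : ℂ) : ℂ := cmhz [(k, x, b)]

/-- Depth-one cyclotomic t-value `t_k(x)`. -/
noncomputable def tval1 (k : ℕ) (x : ℂ) : ℂ := tval [(k, x)]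

/-- The generalized digamma-type series `φ(s; x) = Σ_{k≥0} x^k/(k+s)`. -/
noncomputable def phiF (s x : ℂ) : ℂ :=
  limUnder atTop (fun N : ℕ => ∑ t ∈ Finset.range (N + 1), x ^ t / ((t : ℂ) + s))

/-- The extended trigonometric function `Φ(s; x) = φ(s; x) − φ(−s; x⁻¹) − 1/s`. -/
noncomputable def PhiF (s x : ℂ) : ℂ := phiF s x - phiF (-s) x⁻¹ - 1 / s



/-! ### Iterated sums -/

/-- Iterated sum over `lo < a_0 < ⋯ < a_{n-1} ≤ hi` of `∏ g l (a_l)`. -/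
noncomputable def ES : ℕ → (ℕ → ℕ → ℂ) → ℕ → ℕ → ℂ
  | 0, _, _, _ => 1
  | n + 1, g, lo, hi => ∑ a ∈ Ioc lo hi, g 0 a * ES n (fun l => g (l + 1)) a hi

lemma ES_zero (g : ℕ → ℕ → ℂ) (lo hi : ℕ) : ES 0 g lo hi = 1 := rfl

lemma ES_succ (n : ℕ) (g : ℕ → ℕ → ℂ) (lo hi : ℕ) :
    ES (n + 1) g lo hi = ∑ a ∈ Ioc lo hi, g 0 a * ES n (fun l => g (l + 1)) a hi := rfl

lemma ES_congr (n : ℕ) : ∀ (g g' : ℕ → ℕ → ℂ) (lo hi : ℕ),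
    (∀ l < n, ∀ a, lo < a → a ≤ hi → g l a = g' l a) → ES n g lo hi = ES n g' lo hi := by
  induction n with
  | zero => intros; rfl
  | succ n ih =>
    intro g g' lo hi h
    rw [ES_succ, ES_succ]
    refine Finset.sum_congr rfl fun a ha => ?_
    rw [Finset.mem_Ioc] at ha
    rw [h 0 (by omega) a ha.1 ha.2]
    congr 1
    exact ih _ _ _ _ fun l hl b hb hb' => h (l + 1) (by omega) b (by omega) hb'

lemma ES_append (p q : ℕ) : ∀ (g : ℕ → ℕ → ℂ) (lo hi : ℕ),
    ES (p + 1 + q) g lo hi = ∑ b ∈ Ioc lo hi,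
      ES p g lo (b - 1) * g p b * ES q (fun l => g (p + 1 + l)) b hi := by
  induction p with
  | zero =>
    intro g lo hi
    rw [show 0 + 1 + q = q + 1 by omega, ES_succ]
    refine Finset.sum_congr rfl fun a ha => ?_
    rw [ES_zero, one_mul]
    congr 2
    funext l; congr 1; omega
  | succ p ih =>
    intro g lo hi
    rw [show p + 1 + 1 + q = (p + 1 + q) + 1 by omega, ES_succ]
    simp_rw [ih, ES_succ, Finset.mul_sum, Finset.sum_mul]
    rw [Finset.sum_sigma', Finset.sum_sigma']
    refine Finset.sum_nbij' (fun s => ⟨s.2, s.1⟩) (fun s => ⟨s.2, s.1⟩) ?_ ?_ ?_ ?_ ?_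
    · rintro ⟨a, b⟩ h
      simp only [Finset.mem_sigma, Finset.mem_Ioc] at h ⊢
      omega
    · rintro ⟨a, b⟩ h
      simp only [Finset.mem_sigma, Finset.mem_Ioc] at h ⊢
      omega
    · rintro ⟨a, b⟩ h; rfl
    · rintro ⟨a, b⟩ h; rfl
    · rintro ⟨a, b⟩ h
      have : (fun l => g (p + 1 + l + 1)) = (fun l => g (p + 1 + 1 + l)) := by
        funext l; congr 1; omega
      simp only [this]
      ring

lemma ES_last (n : ℕ) (g : ℕ → ℕ → ℂ) (lo hi : ℕ) :
    ES (n + 1) g lo hi = ∑ b ∈ Ioc lo hi, ES n g lo (b - 1) * g n b := by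
  have := ES_append n 0 g lo hi
  simpa [ES_zero] using this

lemma ES_shift (n : ℕ) : ∀ (g : ℕ → ℕ → ℂ) (lo hi c : ℕ),
    ES n g (lo + c) (hi + c) = ES n (fun l a => g l (a + c)) lo hi := by
  induction n with
  | zero => intros; rfl
  | succ n ih =>
    intro g lo hi c
    rw [ES_succ, ES_succ, ← Finset.image_add_right_Ioc, Finset.sum_image (by simp)]
    exact Finset.sum_congr rfl fun a ha => by rw [ih]

lemma ES_smul (n : ℕ) : ∀ (c : ℕ → ℂ) (g : ℕ → ℕ → ℂ) (lo hi : ℕ),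
    ES n (fun l a => c l * g l a) lo hi = (∏ l ∈ range n, c l) * ES n g lo hi := by
  induction n with
  | zero => intros; simp [ES_zero]
  | succ n ih =>
    intro c g lo hi
    rw [ES_succ, ES_succ, Finset.prod_range_succ', Finset.mul_sum]
    refine Finset.sum_congr rfl fun a ha => ?_
    rw [ih (fun l => c (l + 1)) (fun l => g (l + 1))]
    ring

lemma ES_split (n : ℕ) : ∀ (g : ℕ → ℕ → ℂ) (lo y hi : ℕ), lo ≤ y → y ≤ hi →
    ES n g lo hi = ∑ j ∈ range (n + 1),
      ES j g lo y * ES (n - j) (fun l => g (j + l)) y hi := by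
  induction n with
  | zero => intros; simp [ES_zero]
  | succ n ih =>
    intro g lo y hi h1 h2
    rw [Finset.sum_range_succ', ES_succ, ← Finset.Ioc_union_Ioc_eq_Ioc h1 h2,
      Finset.sum_union (Finset.disjoint_left.2 fun a ha hb => by
        rw [Finset.mem_Ioc] at ha hb; omega)]
    congr 1
    · simp_rw [ES_succ, Finset.sum_mul]
      rw [Finset.sum_comm]
      refine Finset.sum_congr rfl fun a ha => ?_
      rw [Finset.mem_Ioc] at ha
      rw [ih _ a y hi ha.2 h2, Finset.mul_sum]
      refine Finset.sum_congr rfl fun j hj => ?_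
      have : (fun l => g (j + l + 1)) = (fun l => g (j + 1 + l)) := by
        funext l; congr 1; omega
      rw [this, show n + 1 - (j + 1) = n - j by omega]
      ring
    · rw [ES_zero, one_mul, show n + 1 - 0 = n + 1 by omega, ES_succ]
      simp

lemma ES_reflect (n : ℕ) : ∀ (g : ℕ → ℕ → ℂ) (lo M : ℕ), lo ≤ M →
    ES n g lo M = ES n (fun l a => g (n - 1 - l) (M + 1 - a)) 0 (M - lo) := by
  induction n with
  | zero => intros; rfl
  | succ n ih =>
    intro g lo M hlo
    rw [ES_succ, ES_last]
    refine Finset.sum_nbij' (fun a => M + 1 - a) (fun a => M + 1 - a) ?_ ?_ ?_ ?_ ?_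
    · intro a ha; simp only [Finset.mem_Ioc] at ha ⊢; omega
    · intro a ha; simp only [Finset.mem_Ioc] at ha ⊢; omega
    · intro a ha; simp only [Finset.mem_Ioc] at ha ⊢; omega
    · intro a ha; simp only [Finset.mem_Ioc] at ha ⊢; omega
    · intro a ha
      simp only [Finset.mem_Ioc] at ha
      rw [ih _ a M ha.2, mul_comm]
      rw [show M + 1 - a - 1 = M - a by omega, show M + 1 - (M + 1 - a) = a by omega,
        show n + 1 - 1 - n = 0 by omega]
      congr 1
      refine ES_congr _ _ _ _ _ fun l hl b hb hb' => ?_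
      congr 1
      omega

/-- Strictly increasing tuples in `(lo, hi]`. -/
noncomputable def conf (r lo hi : ℕ) : Finset (Fin r → ℕ) := by
  classical
  exact (Fintype.piFinset fun _ => Ioc lo hi).filter StrictMono

lemma mem_conf {r lo hi : ℕ} {a : Fin r → ℕ} :
    a ∈ conf r lo hi ↔ (∀ i, lo < a i ∧ a i ≤ hi) ∧ StrictMono a := by
  simp [conf, Fintype.mem_piFinset]

lemma conf_sum (r : ℕ) : ∀ (g : ℕ → ℕ → ℂ) (lo hi : ℕ),
    ∑ a ∈ conf r lo hi, ∏ l : Fin r, g l (a l) = ES r g lo hi := by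
  induction r with
  | zero =>
    intro g lo hi
    have : conf 0 lo hi = {![]} := by
      ext a
      simp only [mem_conf, Finset.mem_singleton]
      refine ⟨fun _ => Subsingleton.elim _ _, fun _ => ⟨fun i => i.elim0, fun i => i.elim0⟩⟩
    rw [this]; simp [ES_zero]
  | succ r ih =>
    intro g lo hi
    rw [ES_succ]
    simp_rw [← ih, Finset.mul_sum]
    rw [Finset.sum_sigma']
    symm
    refine Finset.sum_nbij' (fun s => Fin.cons s.1 s.2) (fun a => ⟨a 0, fun i => a i.succ⟩)
      ?_ ?_ ?_ ?_ ?_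
    · rintro ⟨a, f⟩ h
      simp only [Finset.mem_sigma, Finset.mem_Ioc, mem_conf] at h ⊢
      refine ⟨fun i => ?_, ?_⟩
      · refine Fin.cases ?_ (fun i => ?_) i
        · simpa using h.1
        · have := h.2.1 i
          simp only [Fin.cons_succ]; omega
      · intro i j hij
        induction j using Fin.cases with
        | zero => simp at hij
        | succ j =>
          induction i using Fin.cases with
          | zero => simpa using (h.2.1 j).1
          | succ i => simpa using h.2.2 (by simpa using hij)
    · intro a h
      simp only [Finset.mem_sigma, Finset.mem_Ioc, mem_conf] at h ⊢
      exact ⟨h.1 0, fun i => ⟨h.2 (Fin.succ_pos i), (h.1 _).2⟩,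
        fun i j hij => h.2 (by simpa using hij)⟩
    · rintro ⟨a, f⟩ h; simp
    · intro a h
      simp only
      exact Fin.cons_self_tail a
    · rintro ⟨a, f⟩ h
      simp [Fin.prod_univ_succ]

lemma conf_sum_at (r j : ℕ) (hj : j < r) (φ : ℕ → ℕ → ℕ → ℂ) (N : ℕ) :
    ∑ a ∈ conf r 0 N, ∏ l : Fin r, φ (a ⟨j, hj⟩) l (a l) =
      ∑ b ∈ Ioc 0 N, ES j (φ b) 0 (b - 1) * φ b j b *
        ES (r - (j + 1)) (fun l => φ b (j + 1 + l)) b N := by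
  have key : ∀ b ∈ Ioc 0 N,
      ES j (φ b) 0 (b - 1) * φ b j b * ES (r - (j + 1)) (fun l => φ b (j + 1 + l)) b N
      = ∑ a ∈ conf r 0 N, if a ⟨j, hj⟩ = b then ∏ l : Fin r, φ b l (a l) else 0 := by
    intro b hb
    have h1 := conf_sum r (fun l a => if l = j then (if a = b then φ b l a else 0) else φ b l a) 0 N
    have h2 : ∀ a : Fin r → ℕ, (if a ⟨j, hj⟩ = b then ∏ l : Fin r, φ b l (a l) else 0) =
        ∏ l : Fin r, (if (l : ℕ) = j then (if a l = b then φ b l (a l) else 0)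
          else φ b l (a l)) := by
      intro a
      split_ifs with h
      · refine Finset.prod_congr rfl fun l _ => ?_
        split_ifs with h3 h4
        · rfl
        · exfalso; apply h4; rw [← h]; congr 1; exact Fin.ext h3
        · rfl
      · symm
        apply Finset.prod_eq_zero (Finset.mem_univ (⟨j, hj⟩ : Fin r))
        simp [h]
    simp_rw [h2]
    rw [h1]
    obtain ⟨t, rfl⟩ : ∃ t, r = j + 1 + t := ⟨r - (j + 1), by omega⟩
    rw [ES_append, Finset.sum_eq_single b]
    · rw [show j + 1 + t - (j + 1) = t by omega]
      simp only [if_true]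
      congr 1
      · congr 1
        refine ES_congr _ _ _ _ _ fun l hl a _ _ => ?_
        rw [if_neg (by omega)]
      · refine ES_congr _ _ _ _ _ fun l hl a _ _ => ?_
        rw [if_neg (by omega)]
    · intro c _ hc
      simp [hc]
    · intro h; exact absurd hb h
  rw [Finset.sum_congr rfl key, Finset.sum_comm]
  refine Finset.sum_congr rfl fun a ha => ?_
  rw [Finset.sum_ite_eq, if_pos]
  rw [mem_conf] at ha
  rw [Finset.mem_Ioc]
  exact ha.1 _

lemma cmhzP_eq (K : List (ℕ × ℂ × ℂ)) (N : ℕ) (g : ℕ → ℕ → ℂ)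
    (hg : ∀ (j : Fin K.length) (a : ℕ), g j a = (K.get j).2.1 ^ a /
      ((a : ℂ) + (K.get j).2.2 - 1) ^ (K.get j).1) :
    cmhzP K N = ES K.length g 0 N := by
  classical
  rw [← conf_sum, cmhzP]
  refine Finset.sum_bij (fun n _ => fun j => (n j : ℕ) + 1) ?_ ?_ ?_ ?_
  · intro n hn
    simp only [Finset.mem_filter, Finset.mem_univ, true_and] at hn
    rw [mem_conf]
    refine ⟨fun i => ⟨by omega, by have := (n i).isLt; omega⟩, fun i j hij => ?_⟩
    have := hn hij
    simpa using this
  · intro n _ m _ h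
    funext i
    have : (n i : ℕ) + 1 = (m i : ℕ) + 1 := congrFun h i
    exact Fin.ext (by omega)
  · intro a ha
    rw [mem_conf] at ha
    refine ⟨fun i => ⟨a i - 1, by have := ha.1 i; omega⟩, ?_, ?_⟩
    · simp only [Finset.mem_filter, Finset.mem_univ, true_and]
      intro i j hij
      have h1 := ha.2 hij
      have h2 := ha.1 i
      have h3 := ha.1 j
      simp only [Fin.mk_lt_mk]; omega
    · funext i
      have h2 := ha.1 i
      simp only; omega
  · intro n _
    refine Finset.prod_congr rfl fun j _ => ?_
    rw [hg]

/-- The basic summand. -/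
noncomputable def gterm (β : ℝ) (k : ℕ → ℕ) (x : ℕ → ℂ) (l a : ℕ) : ℂ :=
  x l ^ a / ((a : ℂ) - (β : ℂ)) ^ k l

lemma cmhzP_ofFn (n : ℕ) (k : ℕ → ℕ) (x : ℕ → ℂ) (β : ℝ) (b : ℂ) (hb : b = 1 - β)
    (L : List (ℕ × ℂ)) (hL : L.length = n)
    (hLk : ∀ (l : ℕ) (h : l < L.length), L[l] = (k l, x l)) (N : ℕ) :
    cmhzP (L.map fun p => (p.1, p.2, b)) N = ES n (gterm β k x) 0 N := by
  rw [cmhzP_eq _ N (gterm β k x)]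
  · simp [hL]
  · intro j a
    have h : (j : ℕ) < L.length := by have := j.isLt; simpa using this
    simp only [List.get_eq_getElem, List.getElem_map, hLk _ h, gterm]
    congr 2
    rw [hb]; ring

/-! ### Elementary estimates -/

/-- Harmonic numbers, as a real sum. -/
noncomputable def hH (N : ℕ) : ℝ := ∑ a ∈ Ioc 0 N, 1 / (a : ℝ)

/-- The weight `b ^ (-3/4)`. -/
noncomputable def wt (b : ℕ) : ℝ := (b : ℝ) ^ (-(3 / 4) : ℝ)

lemma hH_nonneg (N : ℕ) : 0 ≤ hH N := Finset.sum_nonneg fun a _ => by positivity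

lemma hH_mono {M N : ℕ} (h : M ≤ N) : hH M ≤ hH N :=
  Finset.sum_le_sum_of_subset_of_nonneg (Finset.Ioc_subset_Ioc_right h)
    fun a _ _ => by positivity

lemma hH_le (N : ℕ) (ε : ℝ) (hε : 0 < ε) (hN : 1 ≤ N) :
    hH N ≤ (1 + 1 / ε) * (N : ℝ) ^ ε := by
  have h1 : hH N = (harmonic N : ℝ) := by
    rw [harmonic_eq_sum_Icc, hH]
    push_cast
    refine Finset.sum_congr ?_ fun a _ => by simp
    ext a; simp [Finset.mem_Ioc, Finset.mem_Icc]; omega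
  have h2 := harmonic_le_one_add_log N
  have hN' : (1 : ℝ) ≤ N := by exact_mod_cast hN
  have h3 : Real.log N ≤ (N : ℝ) ^ ε / ε := Real.log_le_rpow_div (by linarith) hε
  have h4 : (1 : ℝ) ≤ (N : ℝ) ^ ε := Real.one_le_rpow hN' hε.le
  rw [h1]
  calc (harmonic N : ℝ) ≤ 1 + Real.log N := h2
    _ ≤ (N : ℝ) ^ ε + (N : ℝ) ^ ε / ε := by linarith
    _ = _ := by ring

lemma wt_pos {b : ℕ} (hb : 1 ≤ b) : 0 < wt b :=
  Real.rpow_pos_of_pos (by exact_mod_cast hb) _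

lemma wt_nonneg (b : ℕ) : 0 ≤ wt b := Real.rpow_nonneg (by positivity) _

lemma wt_anti {a b : ℕ} (ha : 1 ≤ a) (hab : a ≤ b) : wt b ≤ wt a := by
  refine Real.rpow_le_rpow_of_nonpos (by exact_mod_cast ha) (by exact_mod_cast hab) (by norm_num)

lemma wt_le_one {a : ℕ} (ha : 1 ≤ a) : wt a ≤ 1 := by
  have := wt_anti le_rfl ha
  simpa [wt] using this

lemma mul_wt {b : ℕ} (hb : 1 ≤ b) : (b : ℝ) * wt b = (b : ℝ) ^ (1 / 4 : ℝ) := by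
  have : (0 : ℝ) < b := by exact_mod_cast hb
  rw [wt]
  nth_rewrite 1 [← Real.rpow_one (b : ℝ)]
  rw [← Real.rpow_add this]; norm_num

lemma inv_le_wt {b : ℕ} (hb : 1 ≤ b) : 1 / (b : ℝ) ≤ wt b := by
  have h0 : (1 : ℝ) ≤ b := by exact_mod_cast hb
  rw [div_le_iff₀ (by linarith), mul_comm, mul_wt hb]
  exact Real.one_le_rpow h0 (by norm_num)

lemma wt_div_le {b : ℕ} (hb : 1 ≤ b) : wt b / b ≤ 3 * (wt b - wt (b + 1)) := by
  have h0 : (1 : ℝ) ≤ b := by exact_mod_cast hb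
  have h0' : (0 : ℝ) < b := by linarith
  have h1 : wt (b + 1) ≤ wt b * (1 - 3 / 4 / (b + 1)) := by
    have hB := rpow_one_add_le_one_add_mul_self (s := -1 / ((b : ℝ) + 1)) (by
      rw [le_div_iff₀ (by linarith)]; linarith) (p := 3 / 4) (by norm_num) (by norm_num)
    have e1 : 1 + -1 / ((b : ℝ) + 1) = b / (b + 1) := by field_simp; ring
    rw [e1, Real.div_rpow (by linarith) (by linarith)] at hB
    have e2 : wt b = ((b : ℝ) ^ (3 / 4 : ℝ))⁻¹ := by rw [wt, Real.rpow_neg h0'.le]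
    have e3 : wt (b + 1) = (((b : ℝ) + 1) ^ (3 / 4 : ℝ))⁻¹ := by
      rw [wt, Real.rpow_neg (by positivity)]; push_cast; rfl
    have p1 : 0 < (b : ℝ) ^ (3 / 4 : ℝ) := by positivity
    have p2 : 0 < ((b : ℝ) + 1) ^ (3 / 4 : ℝ) := by positivity
    rw [e2, e3]
    have : (((b : ℝ) + 1) ^ (3 / 4 : ℝ))⁻¹ = ((b : ℝ) ^ (3 / 4 : ℝ))⁻¹ *
        ((b : ℝ) ^ (3 / 4 : ℝ) / ((b : ℝ) + 1) ^ (3 / 4 : ℝ)) := by field_simp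
    rw [this]
    refine mul_le_mul_of_nonneg_left ?_ (by positivity)
    calc _ ≤ _ := hB
      _ = _ := by ring
  have h2 : wt b / b ≤ 3 * (wt b * (3 / 4 / (b + 1))) := by
    have : 1 / (b : ℝ) ≤ 3 * (3 / 4 / (b + 1)) := by
      rw [div_le_iff₀ h0']
      have : 3 * (3 / 4 / ((b : ℝ) + 1)) * b = (9 * b) / (4 * (b + 1)) := by field_simp; ring
      rw [this, le_div_iff₀ (by linarith)]; linarith
    calc wt b / b = wt b * (1 / b) := by ring
      _ ≤ wt b * (3 * (3 / 4 / (b + 1))) := mul_le_mul_of_nonneg_left this (wt_nonneg b)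
      _ = _ := by ring
  linarith

lemma sum_Ioc_telescope {E : Type*} [AddCommGroup E] (f : ℕ → E) {M' M : ℕ} (h : M' ≤ M) :
    ∑ b ∈ Ioc M' M, (f (b + 1) - f b) = f (M + 1) - f (M' + 1) := by
  induction M, h using Nat.le_induction with
  | base => simp
  | succ M h ih =>
    rw [← Finset.insert_Ioc_right_eq_Ioc_add_one h, Finset.sum_insert (by simp), ih]; abel

lemma sum_wt_div_le {M' M : ℕ} (h : M' ≤ M) : ∑ b ∈ Ioc M' M, wt b / b ≤ 3 * wt (M' + 1) := by
  have h1 : ∑ b ∈ Ioc M' M, wt b / b ≤ ∑ b ∈ Ioc M' M, -3 * (wt (b + 1) - wt b) := by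
    refine Finset.sum_le_sum fun b hb => ?_
    rw [Finset.mem_Ioc] at hb
    have := wt_div_le (b := b) (by omega)
    linarith
  rw [← Finset.mul_sum, sum_Ioc_telescope wt h] at h1
  have := wt_nonneg (M + 1)
  linarith

lemma pow_hH_le (n : ℕ) : ∃ C : ℝ, 0 ≤ C ∧ ∀ b : ℕ, 1 ≤ b → (2 * hH b) ^ n ≤ C * (b * wt b) := by
  rcases Nat.eq_zero_or_pos n with rfl | hn
  · refine ⟨1, zero_le_one, fun b hb => ?_⟩
    rw [mul_wt hb, pow_zero, one_mul]
    exact Real.one_le_rpow (by exact_mod_cast hb) (by norm_num)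
  · have hn' : (0 : ℝ) < n := by exact_mod_cast hn
    refine ⟨(2 * (1 + 1 / (1 / (4 * n) : ℝ))) ^ n, by positivity, fun b hb => ?_⟩
    have h1 := hH_le b (1 / (4 * n)) (by positivity) hb
    rw [mul_wt hb]
    have h2 : ((b : ℝ) ^ (1 / (4 * n) : ℝ)) ^ n = (b : ℝ) ^ (1 / 4 : ℝ) := by
      rw [← Real.rpow_natCast, ← Real.rpow_mul (by positivity)]
      congr 1; field_simp
    rw [← h2, ← mul_pow]
    refine pow_le_pow_left₀ (by have := hH_nonneg b; linarith) ?_ n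
    calc 2 * hH b ≤ 2 * ((1 + 1 / (1 / (4 * n) : ℝ)) * (b : ℝ) ^ (1 / (4 * n) : ℝ)) := by linarith
      _ = _ := by ring

lemma tendsto_rpow_neg (s : ℝ) (hs : 0 < s) :
    Tendsto (fun N : ℕ => (N : ℝ) ^ (-s)) atTop (nhds 0) :=
  (tendsto_rpow_neg_atTop hs).comp tendsto_natCast_atTop_atTop

lemma wt_tendsto : Tendsto wt atTop (nhds 0) := tendsto_rpow_neg (3 / 4) (by norm_num)

lemma hH_wt_tendsto : Tendsto (fun N => hH N * wt N) atTop (nhds 0) := by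
  have h : Tendsto (fun N : ℕ => 5 * (N : ℝ) ^ (-(1 / 2) : ℝ)) atTop (nhds 0) := by
    simpa using (tendsto_rpow_neg (1 / 2) (by norm_num)).const_mul 5
  refine squeeze_zero' (Eventually.of_forall fun N => mul_nonneg (hH_nonneg N) (wt_nonneg N)) ?_ h
  filter_upwards [eventually_ge_atTop 1] with N hN
  have h1 := hH_le N (1 / 4) (by norm_num) hN
  have : (0 : ℝ) < N := by exact_mod_cast hN
  calc hH N * wt N ≤ (1 + 1 / (1 / 4)) * (N : ℝ) ^ (1 / 4 : ℝ) * wt N :=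
        mul_le_mul_of_nonneg_right h1 (wt_nonneg N)
    _ = 5 * ((N : ℝ) ^ (1 / 4 : ℝ) * (N : ℝ) ^ (-(3 / 4) : ℝ)) := by rw [wt]; ring
    _ = _ := by rw [← Real.rpow_add this]; norm_num

lemma conv_wt_tendsto :
    Tendsto (fun N : ℕ => ∑ a ∈ Ioc 0 N, wt a * wt (N + 1 - a)) atTop (nhds 0) := by
  have h : Tendsto (fun N : ℕ => 10 * (N : ℝ) ^ (-(1 / 4) : ℝ)) atTop (nhds 0) := by
    simpa using (tendsto_rpow_neg (1 / 4) (by norm_num)).const_mul 10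
  refine squeeze_zero' (Eventually.of_forall fun N => Finset.sum_nonneg fun a _ =>
    mul_nonneg (wt_nonneg _) (wt_nonneg _)) ?_ h
  filter_upwards [eventually_ge_atTop 1] with N hN
  have hNp : (0 : ℝ) < N := by exact_mod_cast hN
  have key : ∀ a ∈ Ioc 0 N, wt a * wt (N + 1 - a) ≤
      (N : ℝ) ^ (-(1 / 2) : ℝ) * (1 / (a : ℝ) + 1 / ((N + 1 - a : ℕ) : ℝ)) := by
    intro a ha
    rw [Finset.mem_Ioc] at ha
    have hc : 1 ≤ N + 1 - a := by omega
    have hsum : (a : ℝ) + ((N + 1 - a : ℕ) : ℝ) = N + 1 := by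
      have : a + (N + 1 - a) = N + 1 := by omega
      exact_mod_cast this
    have hcN : ((N + 1 - a : ℕ) : ℝ) ≤ N := by
      have : N + 1 - a ≤ N := by omega
      exact_mod_cast this
    have haN : (a : ℝ) ≤ N := by exact_mod_cast ha.2
    have hap : (0 : ℝ) < a := by exact_mod_cast ha.1
    have hcp : (0 : ℝ) < ((N + 1 - a : ℕ) : ℝ) := by exact_mod_cast hc
    have m1 := mul_wt (b := a) (by omega)
    have m2 := mul_wt hc
    generalize ((N + 1 - a : ℕ) : ℝ) = c at *
    generalize wt (N + 1 - a) = v at *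
    generalize wt a = u at *
    have b1 : (a : ℝ) ^ (1 / 4 : ℝ) ≤ (N : ℝ) ^ (1 / 4 : ℝ) :=
      Real.rpow_le_rpow hap.le haN (by norm_num)
    have b2 : c ^ (1 / 4 : ℝ) ≤ (N : ℝ) ^ (1 / 4 : ℝ) :=
      Real.rpow_le_rpow hcp.le hcN (by norm_num)
    have b3 : (N : ℝ) ^ (1 / 4 : ℝ) * (N : ℝ) ^ (1 / 4 : ℝ) = (N : ℝ) ^ (-(1 / 2) : ℝ) * N := by
      rw [← Real.rpow_add hNp]
      nth_rewrite 3 [← Real.rpow_one (N : ℝ)]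
      rw [← Real.rpow_add hNp]; norm_num
    have b4 : (a * u) * (c * v) ≤ (N : ℝ) ^ (-(1 / 2) : ℝ) * (N + 1) := by
      rw [m1, m2]
      calc _ ≤ (N : ℝ) ^ (1 / 4 : ℝ) * (N : ℝ) ^ (1 / 4 : ℝ) := by gcongr
        _ = (N : ℝ) ^ (-(1 / 2) : ℝ) * N := b3
        _ ≤ _ := by gcongr; linarith
    have e : (N : ℝ) ^ (-(1 / 2) : ℝ) * (1 / (a : ℝ) + 1 / c)
        = (N : ℝ) ^ (-(1 / 2) : ℝ) * (N + 1) / (a * c) := by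
      rw [← hsum]; field_simp; ring
    rw [e, le_div_iff₀ (by positivity)]
    calc u * v * (a * c) = (a * u) * (c * v) := by ring
      _ ≤ _ := b4
  refine (Finset.sum_le_sum key).trans ?_
  rw [← Finset.mul_sum, Finset.sum_add_distrib]
  have hrefl : ∑ a ∈ Ioc 0 N, 1 / ((N + 1 - a : ℕ) : ℝ) = hH N := by
    rw [hH]
    refine Finset.sum_nbij' (fun a => N + 1 - a) (fun a => N + 1 - a) ?_ ?_ ?_ ?_ ?_
    · intro a ha; simp only [Finset.mem_Ioc] at ha ⊢; omega
    · intro a ha; simp only [Finset.mem_Ioc] at ha ⊢; omega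
    · intro a ha; simp only [Finset.mem_Ioc] at ha ⊢; omega
    · intro a ha; simp only [Finset.mem_Ioc] at ha ⊢; omega
    · intro a ha; rfl
  rw [hrefl]
  change (N : ℝ) ^ (-(1 / 2) : ℝ) * (hH N + hH N) ≤ _
  have h1 := hH_le N (1 / 4) (by norm_num) hN
  calc (N : ℝ) ^ (-(1 / 2) : ℝ) * (hH N + hH N)
      ≤ (N : ℝ) ^ (-(1 / 2) : ℝ) * (10 * (N : ℝ) ^ (1 / 4 : ℝ)) := by
        refine mul_le_mul_of_nonneg_left ?_ (by positivity)
        norm_num at h1 ⊢; linarith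
    _ = 10 * ((N : ℝ) ^ (-(1 / 2) : ℝ) * (N : ℝ) ^ (1 / 4 : ℝ)) := by ring
    _ = _ := by rw [← Real.rpow_add hNp]; norm_num

/-- Convolution lemma. -/
lemma conv_tendsto (u : ℕ → ℂ) (S : ℕ → ℕ → ℂ) (U T : ℂ) (C D : ℝ) (hC : 0 ≤ C)
    (hu : ∀ a, 1 ≤ a → ‖u a‖ ≤ C * wt a)
    (hU : Tendsto (fun N => ∑ a ∈ Ioc 0 N, u a) atTop (nhds U))
    (hS : ∀ N a, 1 ≤ a → a ≤ N → ‖S N a - T‖ ≤ D * wt (N + 1 - a)) :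
    Tendsto (fun N => ∑ a ∈ Ioc 0 N, u a * S N a) atTop (nhds (U * T)) := by
  have h1 : Tendsto (fun N => ∑ a ∈ Ioc 0 N, u a * (S N a - T)) atTop (nhds 0) := by
    have h2 := conv_wt_tendsto.const_mul (C * D)
    rw [mul_zero] at h2
    refine squeeze_zero_norm (fun N => ?_) h2
    refine (norm_sum_le _ _).trans ?_
    rw [Finset.mul_sum]
    refine Finset.sum_le_sum fun a ha => ?_
    rw [Finset.mem_Ioc] at ha
    rw [norm_mul]
    calc _ ≤ (C * wt a) * (D * wt (N + 1 - a)) :=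
          mul_le_mul (hu a ha.1) (hS N a ha.1 ha.2) (norm_nonneg _)
            (mul_nonneg hC (wt_nonneg _))
      _ = _ := by ring
  have h3 := (hU.mul_const T).add h1
  rw [add_zero] at h3
  refine h3.congr fun N => ?_
  rw [Finset.sum_mul, ← Finset.sum_add_distrib]
  exact Finset.sum_congr rfl fun a _ => by ring

/-! ### Convergence with a rate -/

/-- Admissibility of the first `n` entries. -/
def Good (n : ℕ) (k : ℕ → ℕ) (x : ℕ → ℂ) : Prop :=
  (∀ l < n, 0 < k l) ∧ (∀ l < n, ‖x l‖ = 1) ∧ (∀ l, n = l + 1 → ¬(k l = 1 ∧ x l = 1))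

lemma sub_beta_ge {β : ℝ} (hβ : 0 ≤ β ∧ β ≤ 1 / 2) {a : ℕ} (ha : 1 ≤ a) :
    (a : ℝ) / 2 ≤ ‖(a : ℂ) - (β : ℂ)‖ := by
  have h0 : (1 : ℝ) ≤ a := by exact_mod_cast ha
  have : (a : ℂ) - (β : ℂ) = ((a - β : ℝ) : ℂ) := by push_cast; rfl
  rw [this, Complex.norm_real, Real.norm_eq_abs]
  refine le_trans ?_ (le_abs_self _)
  linarith [hβ.2]

lemma gterm_norm {β : ℝ} (hβ : 0 ≤ β ∧ β ≤ 1 / 2) (k : ℕ → ℕ) (x : ℕ → ℂ) (l a : ℕ)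
    (hx : ‖x l‖ = 1) (ha : 1 ≤ a) : ‖gterm β k x l a‖ ≤ 2 ^ k l * (1 / (a : ℝ)) ^ k l := by
  have h0 : (1 : ℝ) ≤ a := by exact_mod_cast ha
  rw [gterm, norm_div, norm_pow, norm_pow, hx, one_pow, ← mul_pow, ← one_div_pow]
  refine pow_le_pow_left₀ (by positivity) ?_ _
  have := sub_beta_ge hβ ha
  rw [div_le_iff₀ (by linarith)]
  have e : 2 * (1 / (a : ℝ)) * (a / 2) = 1 := by field_simp
  calc (1 : ℝ) = 2 * (1 / (a : ℝ)) * (a / 2) := e.symm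
    _ ≤ _ := by gcongr

lemma gterm_norm_le {β : ℝ} (hβ : 0 ≤ β ∧ β ≤ 1 / 2) (k : ℕ → ℕ) (x : ℕ → ℂ) (l a m : ℕ)
    (hx : ‖x l‖ = 1) (ha : 1 ≤ a) (hm : m ≤ k l) :
    ‖gterm β k x l a‖ ≤ 2 ^ k l * (1 / (a : ℝ)) ^ m := by
  have h0 : (1 : ℝ) ≤ a := by exact_mod_cast ha
  refine (gterm_norm hβ k x l a hx ha).trans ?_
  refine mul_le_mul_of_nonneg_left ?_ (by positivity)
  refine pow_le_pow_of_le_one (by positivity) ?_ hm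
  rw [div_le_one (by linarith)]; exact h0

lemma ES_norm_le (n : ℕ) (g : ℕ → ℕ → ℂ) (B : ℝ) (hB : 0 ≤ B) (lo : ℕ) :
    ∀ hi, (∀ l < n, ∀ a, 1 ≤ a → ‖g l a‖ ≤ B * (1 / (a : ℝ))) →
      ‖ES n g lo hi‖ ≤ (B * hH hi) ^ n := by
  induction n with
  | zero => intro hi _; simp [ES_zero]
  | succ n ih =>
    intro hi hg
    rw [ES_last, pow_succ]
    refine (norm_sum_le _ _).trans ?_
    have : B * hH hi = ∑ a ∈ Ioc 0 hi, B * (1 / (a : ℝ)) := by rw [hH, Finset.mul_sum]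
    nth_rewrite 2 [this]
    rw [Finset.mul_sum]
    refine (Finset.sum_le_sum (g := fun a : ℕ => (B * hH hi) ^ n * (B * (1 / (a : ℝ)))) ?_).trans
      (Finset.sum_le_sum_of_subset_of_nonneg (Finset.Ioc_subset_Ioc_left (Nat.zero_le lo)) ?_)
    · intro a ha
      rw [Finset.mem_Ioc] at ha
      rw [norm_mul]
      refine mul_le_mul ?_ (hg n (by omega) a (by omega)) (norm_nonneg _) ?_
      · refine (ih (a - 1) fun l hl => hg l (by omega)).trans ?_
        refine pow_le_pow_left₀ (mul_nonneg hB (hH_nonneg _)) ?_ n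
        exact mul_le_mul_of_nonneg_left (hH_mono (by omega)) hB
      · exact pow_nonneg (mul_nonneg hB (hH_nonneg _)) _
    · intro a _ _
      exact mul_nonneg (pow_nonneg (mul_nonneg hB (hH_nonneg _)) _) (by positivity)

lemma ES_bound {β : ℝ} (hβ : 0 ≤ β ∧ β ≤ 1 / 2) (n : ℕ) (k : ℕ → ℕ) (x : ℕ → ℂ)
    (hk : ∀ l < n, 0 < k l) (hx : ∀ l < n, ‖x l‖ = 1) :
    ∃ C : ℝ, 0 ≤ C ∧ ∀ lo hi b : ℕ, 1 ≤ b → hi ≤ b →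
      ‖ES n (gterm β k x) lo hi‖ ≤ C * (b * wt b) := by
  obtain ⟨C, hC, h⟩ := pow_hH_le n
  set B : ℝ := ∑ l ∈ range n, 2 ^ k l with hBdef
  have hB : 0 ≤ B := Finset.sum_nonneg fun l _ => by positivity
  refine ⟨B ^ n * C, by positivity, fun lo hi b hb hhi => ?_⟩
  refine (ES_norm_le n _ B hB lo hi ?_).trans ?_
  · intro l hl a ha
    have h1 := gterm_norm_le hβ k x l a 1 (hx l hl) ha (hk l hl)
    rw [pow_one] at h1
    refine h1.trans (mul_le_mul_of_nonneg_right ?_ (by positivity))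
    exact Finset.single_le_sum (f := fun l => (2 : ℝ) ^ k l) (fun l _ => by positivity)
      (Finset.mem_range.2 hl)
  · rw [mul_pow, mul_assoc]
    refine mul_le_mul_of_nonneg_left ?_ (by positivity)
    refine le_trans ?_ (h b hb)
    refine pow_le_pow_left₀ (hH_nonneg _) ?_ n
    have := hH_mono hhi
    have := hH_nonneg b
    linarith

lemma abel_rate (f w e : ℕ → ℂ) (C : ℝ)
    (hf : ∀ b, 1 ≤ b → f b = (w (b + 1) - w b) + e b)
    (hw : ∀ b, 1 ≤ b → ‖w b‖ ≤ C * wt b) (he : ∀ b, 1 ≤ b → ‖e b‖ ≤ C * (wt b / b))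
    (hC : 0 ≤ C) {M' M : ℕ} (h : M' ≤ M) :
    ‖∑ b ∈ Ioc M' M, f b‖ ≤ 5 * C * wt (M' + 1) := by
  have h1 : ∑ b ∈ Ioc M' M, f b = (w (M + 1) - w (M' + 1)) + ∑ b ∈ Ioc M' M, e b := by
    rw [← sum_Ioc_telescope w h, ← Finset.sum_add_distrib]
    refine Finset.sum_congr rfl fun b hb => hf b ?_
    rw [Finset.mem_Ioc] at hb; omega
  have h2 : ‖∑ b ∈ Ioc M' M, e b‖ ≤ C * (3 * wt (M' + 1)) := by
    refine (norm_sum_le _ _).trans ?_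
    refine le_trans ?_ (mul_le_mul_of_nonneg_left (sum_wt_div_le h) hC)
    rw [Finset.mul_sum]
    refine Finset.sum_le_sum fun b hb => he b ?_
    rw [Finset.mem_Ioc] at hb; omega
  rw [h1]
  have h3 := hw (M + 1) (by omega)
  have h4 := hw (M' + 1) (by omega)
  have h5 : C * wt (M + 1) ≤ C * wt (M' + 1) :=
    mul_le_mul_of_nonneg_left (wt_anti (by omega) (by omega)) hC
  calc _ ≤ ‖w (M + 1)‖ + ‖w (M' + 1)‖ + ‖∑ b ∈ Ioc M' M, e b‖ :=
        (norm_add_le _ _).trans (by gcongr; exact norm_sub_le _ _)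
    _ ≤ _ := by linarith

lemma ES_diff (n : ℕ) (g : ℕ → ℕ → ℂ) {lo M' M : ℕ} (h1 : lo ≤ M') (h2 : M' ≤ M) :
    ES (n + 1) g lo M - ES (n + 1) g lo M' = ∑ b ∈ Ioc M' M, ES n g lo (b - 1) * g n b := by
  rw [ES_last, ES_last, ← Finset.Ioc_union_Ioc_eq_Ioc h1 h2,
      Finset.sum_union (Finset.disjoint_left.2 fun a ha hb => by
        rw [Finset.mem_Ioc] at ha hb; omega)]
  ring

lemma ES_step {β : ℝ} (hβ : 0 ≤ β ∧ β ≤ 1 / 2) (n : ℕ) (k : ℕ → ℕ) (x : ℕ → ℂ)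
    (hk : ∀ l < n, 0 < k l) (hx : ∀ l < n, ‖x l‖ = 1) :
    ∃ C : ℝ, 0 ≤ C ∧ ∀ lo b : ℕ, 1 ≤ b → lo < b →
      ‖ES n (gterm β k x) lo b - ES n (gterm β k x) lo (b - 1)‖ ≤ C * wt b := by
  rcases n with _ | n
  · exact ⟨0, le_rfl, fun lo b hb _ => by simp [ES_zero]⟩
  · obtain ⟨C, hC, h⟩ := ES_bound hβ n k x (fun l hl => hk l (by omega))
      (fun l hl => hx l (by omega))
    refine ⟨C * 2 ^ k n, by positivity, fun lo b hb hlo => ?_⟩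
    rw [ES_diff n _ (by omega) (by omega : b - 1 ≤ b)]
    have : Ioc (b - 1) b = {b} := by ext c; simp; omega
    rw [this, Finset.sum_singleton, norm_mul]
    have h1 := gterm_norm_le hβ k x n b 1 (hx n (by omega)) hb (hk n (by omega))
    rw [pow_one] at h1
    have hb' : (0 : ℝ) < b := by exact_mod_cast hb
    calc _ ≤ (C * (b * wt b)) * (2 ^ k n * (1 / (b : ℝ))) :=
          mul_le_mul (h lo (b - 1) b hb (by omega)) h1 (norm_nonneg _)
            (mul_nonneg hC (mul_nonneg hb'.le (wt_nonneg _)))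
      _ = _ := by field_simp

lemma ES_rate {β : ℝ} (hβ : 0 ≤ β ∧ β ≤ 1 / 2) (n : ℕ) (k : ℕ → ℕ) (x : ℕ → ℂ)
    (hG : Good n k x) : ∃ C : ℝ, 0 ≤ C ∧ ∀ lo M' M : ℕ, lo ≤ M' → M' ≤ M →
      ‖ES n (gterm β k x) lo M - ES n (gterm β k x) lo M'‖ ≤ C * wt (M' + 1) := by
  obtain ⟨hk, hx, hlast⟩ := hG
  rcases n with _ | n
  · exact ⟨0, le_rfl, fun lo M' M _ _ => by simp [ES_zero]⟩
  have hk' : ∀ l < n, 0 < k l := fun l hl => hk l (by omega)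
  have hx' : ∀ l < n, ‖x l‖ = 1 := fun l hl => hx l (by omega)
  obtain ⟨C, hC, hE⟩ := ES_bound hβ n k x hk' hx'
  obtain ⟨D, hD, hS⟩ := ES_step hβ n k x hk' hx'
  have hxn := hx n (by omega)
  by_cases hk2 : 2 ≤ k n
  · refine ⟨5 * (C * 2 ^ k n), by positivity, fun lo M' M h1 h2 => ?_⟩
    rw [ES_diff n _ h1 h2]
    refine abel_rate _ (fun _ => 0) (fun b => ES n (gterm β k x) lo (b - 1) * gterm β k x n b)
      _ (fun b hb => by ring) (fun b hb => ?_) (fun b hb => ?_) (by positivity) h2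
    · rw [norm_zero]; exact mul_nonneg (by positivity) (wt_nonneg _)
    · have hb' : (0 : ℝ) < b := by exact_mod_cast hb
      have h3 := gterm_norm_le hβ k x n b 2 hxn hb hk2
      rw [norm_mul]
      calc _ ≤ (C * (b * wt b)) * (2 ^ k n * (1 / (b : ℝ)) ^ 2) :=
            mul_le_mul (hE lo (b - 1) b hb (by omega)) h3 (norm_nonneg _)
              (mul_nonneg hC (mul_nonneg hb'.le (wt_nonneg _)))
        _ = _ := by field_simp
  · have hk1 : k n = 1 := by have := hk n (by omega); omega
    have hx1 : x n ≠ 1 := fun h => hlast n rfl ⟨hk1, h⟩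
    have hx1' : x n - 1 ≠ 0 := sub_ne_zero.2 hx1
    set δ : ℝ := ‖x n - 1‖⁻¹ with hδ
    have hδ0 : 0 ≤ δ := by positivity
    refine ⟨5 * (δ * (2 * D + 4 * C)), by positivity, fun lo M' M h1 h2 => ?_⟩
    rw [ES_diff n _ h1 h2]
    -- cut off below `lo`, where the estimates are not needed
    set F : ℕ → ℂ := fun b => ES n (gterm β k x) lo (b - 1) with hF
    set v : ℕ → ℂ := fun b => F b / ((b : ℂ) - β) with hv
    have hne : ∀ b : ℕ, 1 ≤ b → (b : ℂ) - (β : ℂ) ≠ 0 := fun b hb h0 => by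
      have := sub_beta_ge hβ hb
      rw [h0, norm_zero] at this
      have : (1 : ℝ) ≤ b := by exact_mod_cast hb
      linarith
    have hstep : ∀ b : ℕ, 1 ≤ b → ‖F (b + 1) - F b‖ ≤ D * wt b := by
      intro b hb
      simp only [hF, Nat.add_sub_cancel]
      by_cases hlo : lo < b
      · exact hS lo b hb hlo
      · have : ES n (gterm β k x) lo b = ES n (gterm β k x) lo (b - 1) := by
          rcases n with _ | n
          · rfl
          · rw [ES_succ, ES_succ, Finset.Ioc_eq_empty (by omega), Finset.Ioc_eq_empty (by omega),
              Finset.sum_empty, Finset.sum_empty]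
        rw [this, sub_self, norm_zero]
        exact mul_nonneg hD (wt_nonneg _)
    have hinv : ∀ b : ℕ, 1 ≤ b → ‖((b : ℂ) - (β : ℂ))⁻¹‖ ≤ 2 / b := by
      intro b hb
      have hb' : (0 : ℝ) < b := by exact_mod_cast hb
      rw [norm_inv]
      have := sub_beta_ge hβ hb
      calc _ ≤ ((b : ℝ) / 2)⁻¹ := inv_anti₀ (by positivity) this
        _ = _ := by rw [inv_div]
    refine abel_rate _ (fun b => x n ^ b * v b / (x n - 1))
      (fun b => -(x n ^ (b + 1) * (v (b + 1) - v b) / (x n - 1))) _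
      (fun b hb => ?_) (fun b hb => ?_) (fun b hb => ?_) (by positivity) h2
    · have : ES n (gterm β k x) lo (b - 1) * gterm β k x n b = x n ^ b * v b := by
        simp only [hv, hF, gterm, hk1, pow_one]; ring
      rw [this]
      field_simp
      ring
    · have hb' : (0 : ℝ) < b := by exact_mod_cast hb
      have hn1 : ‖v b‖ ≤ 2 * C * wt b := by
        simp only [hv]
        rw [div_eq_mul_inv, norm_mul]
        calc _ ≤ (C * (b * wt b)) * (2 / b) :=
            mul_le_mul (hE lo (b - 1) b hb (by omega)) (hinv b hb) (norm_nonneg _)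
              (mul_nonneg hC (mul_nonneg hb'.le (wt_nonneg _)))
          _ = _ := by field_simp
      rw [norm_div, norm_mul, norm_pow, hxn, one_pow, one_mul, div_eq_mul_inv, ← hδ]
      have hwn := wt_nonneg b
      calc ‖v b‖ * δ ≤ (2 * C * wt b) * δ := by gcongr
        _ ≤ δ * (2 * D + 4 * C) * wt b := by
          have : 0 ≤ δ * wt b * (2 * D + 2 * C) := by positivity
          linarith
    · have hb' : (0 : ℝ) < b := by exact_mod_cast hb
      have hb1 : (0 : ℝ) < b + 1 := by positivity
      have hdec : v (b + 1) - v b = (F (b + 1) - F b) * (((b + 1 : ℕ) : ℂ) - β)⁻¹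
          - F b * (((b : ℂ) - β)⁻¹ * (((b + 1 : ℕ) : ℂ) - β)⁻¹) := by
        have e1 := hne b hb
        have e2 := hne (b + 1) (by omega)
        simp only [hv]
        field_simp
        push_cast
        ring
      have hinv1 : ‖(((b + 1 : ℕ) : ℂ) - (β : ℂ))⁻¹‖ ≤ 2 / b := by
        refine (hinv (b + 1) (by omega)).trans ?_
        push_cast
        gcongr
        linarith
      have hwn := wt_nonneg b
      have hn2 : ‖v (b + 1) - v b‖ ≤ (2 * D + 4 * C) * (wt b / b) := by
        rw [hdec]
        refine (norm_sub_le _ _).trans ?_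
        rw [norm_mul, norm_mul, norm_mul]
        calc _ ≤ (D * wt b) * (2 / b) + (C * (b * wt b)) * ((2 / b) * (2 / b)) := by
              gcongr
              · exact hstep b hb
              · exact hE lo (b - 1) b hb (by omega)
              · exact hinv b hb
          _ = _ := by field_simp; ring
      rw [norm_neg, norm_div, norm_mul, norm_pow, hxn, one_pow, one_mul, div_eq_mul_inv, ← hδ]
      calc _ ≤ ((2 * D + 4 * C) * (wt b / b)) * δ := by gcongr
        _ = _ := by ring

lemma ES_limit {β : ℝ} (hβ : 0 ≤ β ∧ β ≤ 1 / 2) (n : ℕ) (k : ℕ → ℕ) (x : ℕ → ℂ)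
    (hG : Good n k x) : ∃ T : ℂ, Tendsto (fun N => ES n (gterm β k x) 0 N) atTop (nhds T) ∧
      ∃ C : ℝ, 0 ≤ C ∧ ∀ M, ‖ES n (gterm β k x) 0 M - T‖ ≤ C * wt (M + 1) := by
  obtain ⟨C, hC, h⟩ := ES_rate hβ n k x hG
  have hw : Tendsto (fun M => C * wt (M + 1)) atTop (nhds 0) := by
    simpa using (wt_tendsto.comp (tendsto_add_atTop_nat 1)).const_mul C
  have hcau : CauchySeq (fun N => ES n (gterm β k x) 0 N) := by
    refine cauchySeq_of_le_tendsto_0' (fun M => C * wt (M + 1)) (fun M' M hM => ?_) hw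
    rw [dist_comm, dist_eq_norm]
    exact h 0 M' M (Nat.zero_le _) hM
  obtain ⟨T, hT⟩ := cauchySeq_tendsto_of_complete hcau
  refine ⟨T, hT, C, hC, fun M => ?_⟩
  rw [norm_sub_rev]
  refine le_of_tendsto ((hT.sub_const _).norm) ?_
  filter_upwards [eventually_ge_atTop M] with N hN
  exact h 0 M N (Nat.zero_le _) hN

lemma tval_spec (n : ℕ) (k : ℕ → ℕ) (x : ℕ → ℂ) (hG : Good n k x)
    (L : List (ℕ × ℂ)) (hL : L.length = n)
    (hLk : ∀ (l : ℕ) (h : l < L.length), L[l] = (k l, x l)) :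
    Tendsto (fun N => ES n (gterm (1 / 2) k x) 0 N) atTop (nhds (tval L)) ∧
      ∃ C : ℝ, 0 ≤ C ∧ ∀ M, ‖ES n (gterm (1 / 2) k x) 0 M - tval L‖ ≤ C * wt (M + 1) := by
  obtain ⟨T, hT, h⟩ := ES_limit (β := 1 / 2) (by norm_num) n k x hG
  have : tval L = T := by
    refine Tendsto.limUnder_eq (hT.congr fun N => ?_)
    rw [cmhzP_ofFn n k x (1 / 2) (1 / 2) (by push_cast; ring) L hL hLk]
  rw [this]; exact ⟨hT, h⟩

lemma cmzv_spec (n : ℕ) (k : ℕ → ℕ) (x : ℕ → ℂ) (hG : Good n k x)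
    (L : List (ℕ × ℂ)) (hL : L.length = n)
    (hLk : ∀ (l : ℕ) (h : l < L.length), L[l] = (k l, x l)) :
    Tendsto (fun N => ES n (gterm 0 k x) 0 N) atTop (nhds (cmzv L)) ∧
      ∃ C : ℝ, 0 ≤ C ∧ ∀ M, ‖ES n (gterm 0 k x) 0 M - cmzv L‖ ≤ C * wt (M + 1) := by
  obtain ⟨T, hT, h⟩ := ES_limit (β := 0) (by norm_num) n k x hG
  have : cmzv L = T := by
    refine Tendsto.limUnder_eq (hT.congr fun N => ?_)
    rw [cmhzP_ofFn n k x 0 1 (by push_cast; ring) L hL hLk]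
  rw [this]; exact ⟨hT, h⟩

/-! ### Partial fractions -/

/-- The power series of `(t + d) ^ (-k)`. -/
noncomputable def Bser (d : ℂ) (k : ℕ) : PowerSeries ℂ :=
  PowerSeries.mk fun m => (-1) ^ m * (Nat.choose (m + k - 1) (k - 1) : ℂ) * (d ^ (k + m))⁻¹

lemma Bser_mul (d : ℂ) (hd : d ≠ 0) (k : ℕ) (hk : 0 < k) :
    Bser d k * (PowerSeries.X + PowerSeries.C d) ^ k = 1 := by
  obtain ⟨p, rfl⟩ : ∃ p, k = p + 1 := ⟨k - 1, by omega⟩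
  have h1 : Bser d (p + 1) = PowerSeries.C ((d ^ (p + 1))⁻¹) *
      PowerSeries.rescale (-1 / d) ((PowerSeries.mk 1 : PowerSeries ℂ) ^ (p + 1)) := by
    rw [PowerSeries.mk_one_pow_eq_mk_choose_add]
    ext m
    rw [PowerSeries.coeff_C_mul, PowerSeries.coeff_rescale, PowerSeries.coeff_mk, Bser,
      PowerSeries.coeff_mk, show m + (p + 1) - 1 = p + m by omega, show p + 1 - 1 = p by omega,
      div_pow, pow_add]
    field_simp
  have h2 : (PowerSeries.X + PowerSeries.C d : PowerSeries ℂ) = PowerSeries.C d *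
      PowerSeries.rescale (-1 / d) (1 - PowerSeries.X) := by
    rw [map_sub, map_one, PowerSeries.rescale_X, mul_sub, mul_one, ← mul_assoc, ← map_mul]
    have : d * (-1 / d) = -1 := by field_simp
    rw [this, map_neg, map_one]; ring
  rw [h1, h2, mul_pow, ← map_pow, ← map_pow]
  have h3 : (PowerSeries.mk 1 : PowerSeries ℂ) ^ (p + 1) * (1 - PowerSeries.X) ^ (p + 1) = 1 := by
    rw [← mul_pow, PowerSeries.mk_one_mul_one_sub_eq_one, one_pow]
  calc _ = (PowerSeries.C ((d ^ (p + 1))⁻¹) * PowerSeries.C (d ^ (p + 1))) *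
        (PowerSeries.rescale (-1 / d) ((PowerSeries.mk 1 : PowerSeries ℂ) ^ (p + 1)) *
          PowerSeries.rescale (-1 / d) ((1 - PowerSeries.X) ^ (p + 1))) := by ring
    _ = 1 := by
      rw [← map_mul, ← map_mul, h3, inv_mul_cancel₀ (pow_ne_zero _ hd), map_one, map_one, one_mul]

open Polynomial in
lemma partial_fractions {ι : Type*} [Fintype ι] [DecidableEq ι] [Nonempty ι] (k : ι → ℕ)
    (a : ι → ℂ) (ha : Function.Injective a) (hk : ∀ i, 0 < k i) (s : ℂ) (hs : ∀ i, s + a i ≠ 0) :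
    ∏ i, ((s + a i) ^ k i)⁻¹ = ∑ j, ∑ i ∈ range (k j),
      PowerSeries.coeff (k j - 1 - i) (∏ l, if l = j then 1 else Bser (a l - a j) (k l)) *
        ((s + a j) ^ (i + 1))⁻¹ := by
  set F : ι → PowerSeries ℂ := fun j => ∏ l, if l = j then 1 else Bser (a l - a j) (k l) with hF
  set Q : ι → ℂ[X] := fun j => ∏ l ∈ univ.erase j, (X - C (-a l)) ^ k l with hQ
  set p : ι → ℂ[X] := fun j => (PowerSeries.trunc (k j) (F j)).comp (X - C (-a j)) with hp
  set P : ℂ[X] := 1 - ∑ j, p j * Q j with hP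
  have hdvd1 : ∀ j, (X - C (-a j)) ^ k j ∣ 1 - p j * Q j := by
    intro j
    rw [X_sub_C_pow_dvd_iff, X_pow_dvd_iff]
    intro d hd
    have e1 : (1 - p j * Q j).comp (X + C (-a j)) = 1 - PowerSeries.trunc (k j) (F j) *
        ∏ l ∈ univ.erase j, (X + C (a l - a j)) ^ k l := by
      simp only [hp, hQ, sub_comp, mul_comp, one_comp, comp_assoc, X_comp, C_comp,
        add_sub_cancel_right, comp_X, Polynomial.prod_comp, pow_comp]
      congr 2
      refine Finset.prod_congr rfl fun l _ => ?_
      congr 1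
      simp only [map_sub, map_neg]; ring
    have e2 : F j * ∏ l ∈ univ.erase j, (PowerSeries.X + PowerSeries.C (a l - a j)) ^ k l = 1 := by
      have : F j = ∏ l ∈ univ.erase j, Bser (a l - a j) (k l) := by
        simp only [hF]
        rw [← Finset.mul_prod_erase _ _ (Finset.mem_univ j)]
        simp only [if_true, one_mul]
        refine Finset.prod_congr rfl fun l hl => ?_
        rw [if_neg (Finset.ne_of_mem_erase hl)]
      rw [this, ← Finset.prod_mul_distrib]
      refine Finset.prod_eq_one fun l hl => ?_
      exact Bser_mul _ (sub_ne_zero.2 (ha.ne (Finset.ne_of_mem_erase hl))) _ (hk l)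
    rw [e1, coeff_sub, ← coeff_coe, ← coeff_coe, Polynomial.coe_mul]
    have e3 : ((∏ l ∈ univ.erase j, (X + C (a l - a j)) ^ k l : ℂ[X]) : PowerSeries ℂ) =
        ∏ l ∈ univ.erase j, (PowerSeries.X + PowerSeries.C (a l - a j)) ^ k l := by
      have := map_prod (Polynomial.coeToPowerSeries.ringHom (R := ℂ))
        (fun l => (X + C (a l - a j)) ^ k l) (univ.erase j)
      refine this.trans (Finset.prod_congr rfl fun l _ => ?_)
      rw [map_pow, map_add]
      simp only [Polynomial.coeToPowerSeries.ringHom_apply, Polynomial.coe_X, Polynomial.coe_C]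
    rw [e3]
    have e4 := PowerSeries.coeff_coe_trunc_of_lt
      (f := (PowerSeries.trunc (k j) (F j) : PowerSeries ℂ) *
        ∏ l ∈ univ.erase j, (PowerSeries.X + PowerSeries.C (a l - a j)) ^ k l) hd
    rw [PowerSeries.trunc_trunc_mul, e2, PowerSeries.coeff_coe_trunc_of_lt hd] at e4
    rw [← e4, Polynomial.coe_one, sub_self]
  have hdvd2 : ∀ j, (X - C (-a j)) ^ k j ∣ P := by
    intro j
    have : P = (1 - p j * Q j) - ∑ l ∈ univ.erase j, p l * Q l := by
      rw [hP, ← Finset.add_sum_erase _ _ (Finset.mem_univ j)]; ring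
    rw [this]
    refine dvd_sub (hdvd1 j) (Finset.dvd_sum fun l hl => Dvd.dvd.mul_left ?_ _)
    exact Finset.dvd_prod_of_mem (fun l => (X - C (-a l)) ^ k l)
      (Finset.mem_erase.2 ⟨(Finset.ne_of_mem_erase hl).symm, Finset.mem_univ _⟩)
  have hdvd : (∏ j, (X - C (-a j)) ^ k j) ∣ P := by
    refine Finset.prod_dvd_of_coprime ?_ fun j _ => hdvd2 j
    intro i _ j _ hij
    refine IsCoprime.pow ?_
    exact pairwise_coprime_X_sub_C (s := fun i => -a i) (fun x y h => ha (neg_injective h)) hij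
  have hmonic : ∀ t : Finset ι, (∏ j ∈ t, (X - C (-a j)) ^ k j).Monic := fun t =>
    monic_prod_of_monic _ _ fun j _ => (monic_X_sub_C _).pow _
  have hdeg : ∀ t : Finset ι, (∏ j ∈ t, (X - C (-a j)) ^ k j).degree = ((∑ j ∈ t, k j : ℕ) : WithBot ℕ) := by
    intro t
    rw [degree_eq_natDegree (hmonic t).ne_zero, natDegree_prod_of_monic _ _
      fun j _ => (monic_X_sub_C _).pow _]
    congr 1
    exact_mod_cast Finset.sum_congr rfl fun j _ => by
      rw [(monic_X_sub_C (-a j)).natDegree_pow, natDegree_X_sub_C, mul_one]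
  have hP0 : P = 0 := by
    refine eq_zero_of_dvd_of_degree_lt hdvd ?_
    rw [hdeg]
    refine lt_of_le_of_lt (degree_sub_le _ _) (max_lt ?_ ?_)
    · rw [degree_one]
      obtain ⟨i⟩ := ‹Nonempty ι›
      have : 0 < ∑ j, k j := Finset.sum_pos (fun j _ => hk j) ⟨i, Finset.mem_univ i⟩
      exact_mod_cast this
    · refine (degree_sum_le _ _).trans_lt ?_
      rw [Finset.sup_lt_iff (by exact WithBot.bot_lt_coe _)]
      intro j _
      rw [degree_mul]
      have hpj : (p j).degree < (k j : WithBot ℕ) := by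
        have h1 := PowerSeries.degree_trunc_lt (F j) (k j)
        by_cases h0 : PowerSeries.trunc (k j) (F j) = 0
        · simp only [hp, h0, zero_comp, degree_zero]; exact WithBot.bot_lt_coe _
        · have h2 : (p j).natDegree < k j := by
            simp only [hp, natDegree_comp, natDegree_X_sub_C, mul_one]
            exact (natDegree_lt_iff_degree_lt h0).2 h1
          exact lt_of_le_of_lt degree_le_natDegree (by exact_mod_cast h2)
      have hQj : (Q j).degree = ((∑ l ∈ univ.erase j, k l : ℕ) : WithBot ℕ) := hdeg _
      rw [hQj, ← Finset.add_sum_erase _ _ (Finset.mem_univ j)]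
      rw [Nat.cast_add]
      exact WithBot.add_lt_add_right (by exact WithBot.coe_ne_bot) hpj
  have heval := congrArg (eval s) hP0
  rw [hP, eval_sub, eval_one, eval_finsetSum, eval_zero, sub_eq_zero] at heval
  rw [← mul_one (∏ i, ((s + a i) ^ k i)⁻¹), heval, Finset.mul_sum]
  refine Finset.sum_congr rfl fun j _ => ?_
  rw [← Finset.mul_prod_erase _ _ (Finset.mem_univ j), eval_mul]
  have e5 : eval s (Q j) = ∏ l ∈ univ.erase j, (s + a l) ^ k l := by
    simp [hQ, eval_prod]
  have e6 : eval s (p j) = ∑ i ∈ range (k j), PowerSeries.coeff i (F j) * (s + a j) ^ i := by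
    simp only [hp, eval_comp, eval_sub, eval_X, eval_C, sub_neg_eq_add]
    rw [eval, PowerSeries.eval₂_trunc_eq_sum_range]; rfl
  have e7 : (∏ l ∈ univ.erase j, ((s + a l) ^ k l)⁻¹) * ∏ l ∈ univ.erase j, (s + a l) ^ k l = 1 := by
    rw [← Finset.prod_mul_distrib]
    exact Finset.prod_eq_one fun l _ => inv_mul_cancel₀ (pow_ne_zero _ (hs l))
  rw [e5, e6, ← Finset.sum_range_reflect]
  calc _ = ((s + a j) ^ k j)⁻¹ * (∑ i ∈ range (k j), PowerSeries.coeff (k j - 1 - i) (F j) *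
        (s + a j) ^ (k j - 1 - i)) * ((∏ l ∈ univ.erase j, ((s + a l) ^ k l)⁻¹) *
          ∏ l ∈ univ.erase j, (s + a l) ^ k l) := by ring
    _ = _ := by
      rw [e7, mul_one, Finset.mul_sum]
      refine Finset.sum_congr rfl fun i hi => ?_
      rw [Finset.mem_range] at hi
      have : k j = (k j - 1 - i) + (i + 1) := by omega
      have h3 : ((s + a j) ^ k j)⁻¹ = ((s + a j) ^ (k j - 1 - i))⁻¹ * ((s + a j) ^ (i + 1))⁻¹ := by
        rw [← mul_inv, ← pow_add, ← this]
      rw [h3]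
      have := pow_ne_zero (k j - 1 - i) (hs j)
      change _ = PowerSeries.coeff (k j - 1 - i) (F j) * _
      field_simp

lemma coeff_prod_tuple (r n : ℕ) (P : Fin r → PowerSeries ℂ) :
    PowerSeries.coeff n (∏ l, P l) =
      ∑ m ∈ Finset.Nat.antidiagonalTuple r n, ∏ l, PowerSeries.coeff (m l) (P l) := by
  rw [PowerSeries.coeff_prod]
  refine Finset.sum_bij (fun f _ => ⇑f) ?_ ?_ ?_ ?_
  · intro f hf
    rw [Finset.mem_finsuppAntidiag] at hf
    rw [Finset.Nat.mem_antidiagonalTuple]; exact hf.1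
  · intro f _ g _ h; exact DFunLike.coe_injective h
  · intro m hm
    rw [Finset.Nat.mem_antidiagonalTuple] at hm
    refine ⟨Finsupp.equivFunOnFinite.symm m, ?_, by simp⟩
    rw [Finset.mem_finsuppAntidiag]
    exact ⟨by simpa using hm, Finset.subset_univ _⟩
  · intro f _; rfl

/-- Partial fractions in the shape used below. -/
lemma pf_conf (r : ℕ) (q : ℕ) (hq : 0 < q) (κ : ℕ → ℕ) (hκ : ∀ l < r, 0 < κ l)
    (a : Fin r → ℕ) (ha0 : ∀ l, 0 < a l) (ha : StrictMono a) (s : ℂ) (hs0 : s ≠ 0)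
    (hs : ∀ l, s + (a l : ℂ) ≠ 0) :
    (s ^ q)⁻¹ * ∏ l : Fin r, ((s + (a l : ℂ)) ^ κ l)⁻¹ =
    (∑ i ∈ range q, ∑ m ∈ Finset.Nat.antidiagonalTuple r (q - 1 - i),
      (∏ l : Fin r, (-1) ^ m l * (Nat.choose (m l + κ l - 1) (κ l - 1) : ℂ) *
        ((a l : ℂ) ^ (κ l + m l))⁻¹) * (s ^ (i + 1))⁻¹)
    + ∑ j : Fin r, ∑ i ∈ range (κ j), ∑ m ∈ range (κ j - i),
      ∑ mm ∈ (Finset.Nat.antidiagonalTuple r m).filter (fun mm => mm j = 0),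
        ((-1) ^ (κ j - 1 - i - m) * (Nat.choose (q + κ j - m - i - 2) (q - 1) : ℂ) *
          ((-(a j : ℂ)) ^ (q + κ j - i - m - 1))⁻¹ *
        ∏ l ∈ univ.erase j, ((-1) ^ mm l * (Nat.choose (mm l + κ l - 1) (κ l - 1) : ℂ) *
          ((a l - a j : ℂ) ^ (κ l + mm l))⁻¹)) * ((s + a j) ^ (i + 1))⁻¹ := by
  have hinj : Function.Injective (Fin.cons 0 (fun l => (a l : ℂ)) : Fin (r + 1) → ℂ) := by
    rw [Fin.cons_injective_iff]
    refine ⟨?_, fun l l' h => ha.injective ?_⟩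
    swap
    · have h' : (a l : ℂ) = a l' := h
      exact_mod_cast h'
    rintro ⟨l, hl⟩
    have := ha0 l
    simp only [Nat.cast_eq_zero] at hl
    omega
  have := partial_fractions (Fin.cons q (fun l : Fin r => κ l) : Fin (r + 1) → ℕ)
    (Fin.cons 0 (fun l => (a l : ℂ))) hinj
    (fun i => by refine Fin.cases ?_ (fun i => ?_) i <;> simp [hq, hκ]) s
    (fun i => by refine Fin.cases ?_ (fun i => ?_) i <;> simp [hs0, hs])
  rw [Fin.prod_univ_succ, Fin.sum_univ_succ] at this
  simp only [Fin.cons_zero, Fin.cons_succ, add_zero, Fin.prod_univ_succ, if_true,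
    Fin.succ_ne_zero, if_false, one_mul, sub_zero, zero_sub, Fin.succ_inj,
    (Fin.succ_ne_zero _).symm] at this
  rw [this]
  congr 1
  · refine Finset.sum_congr rfl fun i _ => ?_
    rw [coeff_prod_tuple, Finset.sum_mul]
    simp only [Bser, PowerSeries.coeff_mk]
  · refine Finset.sum_congr rfl fun j _ => Finset.sum_congr rfl fun i hi => ?_
    rw [Finset.mem_range] at hi
    rw [mul_comm (Bser _ _), PowerSeries.coeff_mul, Finset.Nat.sum_antidiagonal_eq_sum_range_succ_mk,
      Finset.sum_mul, show (κ j - 1 - i).succ = κ j - i by omega]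
    refine Finset.sum_congr rfl fun m hm => ?_
    rw [Finset.mem_range] at hm
    rw [coeff_prod_tuple, Finset.sum_filter, Finset.sum_mul, Finset.sum_mul]
    refine Finset.sum_congr rfl fun mm _ => ?_
    rw [← Finset.mul_prod_erase _ _ (Finset.mem_univ j), if_pos rfl, PowerSeries.coeff_one]
    split_ifs with h
    · rw [one_mul]
      have e1 : ∏ l ∈ univ.erase j, PowerSeries.coeff (mm l)
          (if l = j then 1 else Bser ((a l : ℂ) - a j) (κ l)) =
          ∏ l ∈ univ.erase j, ((-1) ^ mm l * (Nat.choose (mm l + κ l - 1) (κ l - 1) : ℂ) *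
          ((a l - a j : ℂ) ^ (κ l + mm l))⁻¹) := by
        refine Finset.prod_congr rfl fun l hl => ?_
        rw [if_neg (Finset.ne_of_mem_erase hl), Bser, PowerSeries.coeff_mk]
      rw [e1, Bser, PowerSeries.coeff_mk,
        show κ j - 1 - i - m + q - 1 = q + κ j - m - i - 2 by omega,
        show q + (κ j - 1 - i - m) = q + κ j - i - m - 1 by omega]
      ring
    · ring

/-! ### The window sums -/

/-- Two-sided window sum. -/
noncomputable def Wf (X : ℂ) (N i b : ℕ) : ℂ :=
  (∑ n ∈ Ioc 0 N, X ^ n * (((n : ℂ) - 1 / 2 + b) ^ (i + 1))⁻¹) +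
    ∑ n ∈ range (N + 1), X⁻¹ ^ n * ((-(n : ℂ) - 1 / 2 + b) ^ (i + 1))⁻¹

/-- Normalised window sum. -/
noncomputable def Vf (X : ℂ) (N i b : ℕ) : ℂ :=
  ES 1 (gterm (1 / 2) (fun _ => i + 1) (fun _ => X)) 0 (N + b) +
    X * (-1) ^ (i + 1) * ES 1 (gterm (1 / 2) (fun _ => i + 1) (fun _ => X⁻¹)) 0 (N + 1 - b)

lemma sum_Ioc_range (f : ℕ → ℂ) (M : ℕ) : ∑ m ∈ Ioc 0 M, f m = ∑ m ∈ range M, f (m + 1) := by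
  induction M with
  | zero => simp
  | succ M ih => rw [Finset.sum_Ioc_succ_top (by omega), ih, Finset.sum_range_succ]

lemma Wf_eq (X : ℂ) (hX : X ≠ 0) (N i b : ℕ) (hb : b ≤ N) :
    Wf X N i b = X⁻¹ ^ b * Vf X N i b := by
  have hXb : ∀ n, X ^ n ≠ 0 := fun n => pow_ne_zero n hX
  have e1 : N + 1 = b + (N + 1 - b) := by omega
  have e2 : N + b = b + N := by omega
  have hXX : ∀ n : ℕ, X⁻¹ ^ n * X ^ n = 1 := fun n => by
    rw [← mul_pow, inv_mul_cancel₀ hX, one_pow]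
  simp only [Wf, Vf, ES_succ, ES_zero, mul_one, sum_Ioc_range]
  rw [e2, Finset.sum_range_add (n := b) (m := N), e1, Finset.sum_range_add, ← e1,
    ← Finset.sum_range_reflect _ b, mul_add, mul_add, Finset.mul_sum, Finset.mul_sum,
    Finset.mul_sum, Finset.mul_sum]
  have h1 : ∀ n ∈ range N, X ^ (n + 1) * ((((n + 1 : ℕ) : ℂ) - 1 / 2 + b) ^ (i + 1))⁻¹ =
      X⁻¹ ^ b * gterm (1 / 2) (fun _ => i + 1) (fun _ => X) 0 (b + n + 1) := by
    intro n _
    rw [gterm, show b + n + 1 = b + (n + 1) by omega, pow_add X b, mul_div_assoc, ← mul_assoc,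
      hXX, one_mul]
    have h : ((n + 1 : ℕ) : ℂ) - 1 / 2 + b = ((b + (n + 1) : ℕ) : ℂ) - ((1 / 2 : ℝ) : ℂ) := by
      push_cast; ring
    rw [h, ← div_eq_mul_inv]
  have h2 : ∀ n ∈ range b, X⁻¹ ^ (b - 1 - n) *
      ((-((b - 1 - n : ℕ) : ℂ) - 1 / 2 + b) ^ (i + 1))⁻¹ =
      X⁻¹ ^ b * gterm (1 / 2) (fun _ => i + 1) (fun _ => X) 0 (n + 1) := by
    intro n hn
    rw [Finset.mem_range] at hn
    obtain ⟨c, rfl⟩ : ∃ c, b = c + (n + 1) := ⟨b - (n + 1), by omega⟩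
    have h : -(c : ℂ) - 1 / 2 + ((c + (n + 1) : ℕ) : ℂ) =
        ((n + 1 : ℕ) : ℂ) - ((1 / 2 : ℝ) : ℂ) := by
      push_cast; ring
    rw [gterm, pow_add X⁻¹ c, mul_assoc, ← mul_div_assoc, hXX,
      show c + (n + 1) - 1 - n = c by omega, h, one_div (_ ^ (i + 1))]
  have h3 : ∀ n ∈ range (N + 1 - b), X⁻¹ ^ (b + n) * ((-((b + n : ℕ) : ℂ) - 1 / 2 + b) ^ (i + 1))⁻¹ =
      X⁻¹ ^ b * (X * (-1) ^ (i + 1) *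
        gterm (1 / 2) (fun _ => i + 1) (fun _ => X⁻¹) 0 (n + 1)) := by
    intro n _
    have : (-((b + n : ℕ) : ℂ) - 1 / 2 + b) = -1 * (((n + 1 : ℕ) : ℂ) - ((1 / 2 : ℝ) : ℂ)) := by
      push_cast; ring
    rw [gterm, this, mul_pow, mul_inv, pow_add, pow_succ X⁻¹ n, div_eq_mul_inv]
    have h4 : ((-1 : ℂ) ^ (i + 1))⁻¹ = (-1) ^ (i + 1) := by
      rw [← inv_pow]; norm_num
    rw [h4]
    field_simp
  rw [Finset.sum_congr rfl h1, Finset.sum_congr rfl h2]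
  rw [Finset.sum_congr rfl h3]
  ring

lemma Vf_rate (X : ℂ) (hX : ‖X‖ = 1) (hX1 : X ≠ 1) (i : ℕ) :
    ∃ C : ℝ, 0 ≤ C ∧ ∀ N b, b ≤ N → ‖Vf X N i b - (-X *
      ((-1 : ℂ) ^ i * tval1 (i + 1) X⁻¹ - X⁻¹ * tval1 (i + 1) X))‖ ≤ C * wt (N + 1 - b) := by
  have hX0 : X ≠ 0 := by rintro rfl; simp at hX
  have hX' : X⁻¹ ≠ 1 := fun h => hX1 (inv_eq_one.1 h)
  obtain ⟨_, C1, hC1, h1⟩ := tval_spec 1 (fun _ => i + 1) (fun _ => X)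
    ⟨fun _ _ => Nat.succ_pos i, fun _ _ => hX, fun _ _ h => hX1 h.2⟩ [(i + 1, X)] rfl
    (fun l h => by simp at h; subst h; rfl)
  obtain ⟨_, C2, hC2, h2⟩ := tval_spec 1 (fun _ => i + 1) (fun _ => X⁻¹)
    ⟨fun _ _ => Nat.succ_pos i, fun _ _ => by rw [norm_inv, hX, inv_one], fun _ _ h => hX' h.2⟩
    [(i + 1, X⁻¹)] rfl (fun l h => by simp at h; subst h; rfl)
  refine ⟨C1 + C2, by positivity, fun N b hb => ?_⟩
  have e : Vf X N i b - (-X *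
      ((-1 : ℂ) ^ i * tval1 (i + 1) X⁻¹ - X⁻¹ * tval1 (i + 1) X)) =
      (ES 1 (gterm (1 / 2) (fun _ => i + 1) (fun _ => X)) 0 (N + b) - tval [(i + 1, X)]) +
      X * (-1) ^ (i + 1) * (ES 1 (gterm (1 / 2) (fun _ => i + 1) (fun _ => X⁻¹)) 0 (N + 1 - b) -
        tval [(i + 1, X⁻¹)]) := by
    rw [Vf, tval1, tval1, pow_succ]
    field_simp
    ring
  rw [e]
  refine (norm_add_le _ _).trans ?_
  rw [add_mul]
  refine add_le_add ((h1 _).trans ?_) ?_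
  · exact mul_le_mul_of_nonneg_left (wt_anti (by omega) (by omega)) hC1
  · rw [norm_mul, norm_mul, hX, norm_pow, norm_neg, norm_one, one_pow, one_mul, one_mul]
    refine (h2 _).trans ?_
    exact mul_le_mul_of_nonneg_left (wt_anti (by omega) (by omega)) hC2

/-! ### The finite identity -/

/-- Extension by zero. -/
def extF (r : ℕ) (mm : Fin r → ℕ) (l : ℕ) : ℕ := if h : l < r then mm ⟨l, h⟩ else 0

lemma extF_fin (r : ℕ) (mm : Fin r → ℕ) (l : Fin r) : extF r mm l = mm l := by
  simp [extF]

/-- Summand for the inner poles. -/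
noncomputable def phiT (κ : ℕ → ℕ) (ξ : ℕ → ℂ) (mm : ℕ → ℕ) (e j : ℕ) (w : ℕ → ℂ)
    (b l a : ℕ) : ℂ :=
  if l = j then ξ j ^ b * ((-(b : ℂ)) ^ e)⁻¹ * w b else
    ξ l ^ a * ((-1) ^ mm l * (Nat.choose (mm l + κ l - 1) (κ l - 1) : ℂ) *
      (((a : ℂ) - b) ^ (κ l + mm l))⁻¹)

/-- Inner sum for the poles at the variables. -/
noncomputable def Dsum (r : ℕ) (κ : ℕ → ℕ) (ξ : ℕ → ℂ) (mm : ℕ → ℕ) (e j : ℕ) (w : ℕ → ℂ)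
    (N : ℕ) : ℂ :=
  ∑ b ∈ Ioc 0 N, ES j (phiT κ ξ mm e j w b) 0 (b - 1) * phiT κ ξ mm e j w b j b *
        ES (r - (j + 1)) (fun l => phiT κ ξ mm e j w b (j + 1 + l)) b N

/-- The left hand side at a point. -/
noncomputable def PP (r q : ℕ) (κ : ℕ → ℕ) (ξ : ℕ → ℂ) (s : ℂ) (N : ℕ) : ℂ :=
  (s ^ q)⁻¹ * ES r (fun l a => ξ l ^ a * ((s + a) ^ κ l)⁻¹) 0 N

lemma PP_eq (r q : ℕ) (hq : 0 < q) (κ : ℕ → ℕ) (hκ : ∀ l < r, 0 < κ l) (ξ : ℕ → ℂ) (s : ℂ) (N : ℕ)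
    (hs : ∀ a : ℕ, s + a ≠ 0) :
    PP r q κ ξ s N =
    (∑ i ∈ range q, ∑ m ∈ Finset.Nat.antidiagonalTuple r (q - 1 - i),
      (∑ a ∈ conf r 0 N, ∏ l : Fin r, ξ l ^ a l *
        ((-1) ^ m l * (Nat.choose (m l + κ l - 1) (κ l - 1) : ℂ) *
        ((a l : ℂ) ^ (κ l + m l))⁻¹)) * ((s + (0 : ℕ)) ^ (i + 1))⁻¹)
    + ∑ j : Fin r, ∑ i ∈ range (κ j), ∑ m ∈ range (κ j - i),
      ∑ mm ∈ (Finset.Nat.antidiagonalTuple r m).filter (fun mm => mm j = 0),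
        ((-1) ^ (κ j - 1 - i - m) * (Nat.choose (q + κ j - m - i - 2) (q - 1) : ℂ)) *
        ∑ a ∈ conf r 0 N, (∏ l : Fin r, phiT κ ξ (extF r mm) (q + κ j - i - m - 1) j
          (fun _ => 1) (a j) l (a l)) * ((s + a j) ^ (i + 1))⁻¹ := by
  have hs0 : s ≠ 0 := by simpa using hs 0
  rw [PP, ← conf_sum, Finset.mul_sum]
  have : ∀ a ∈ conf r 0 N, (s ^ q)⁻¹ * ∏ l : Fin r, (ξ l ^ a l * ((s + a l) ^ κ l)⁻¹) =
      (∏ l : Fin r, ξ l ^ a l) * ((s ^ q)⁻¹ * ∏ l : Fin r, ((s + (a l : ℂ)) ^ κ l)⁻¹) := by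
    intro a _
    rw [Finset.prod_mul_distrib]; ring
  rw [Finset.sum_congr rfl this]
  have h2 := fun a (ha : a ∈ conf r 0 N) => pf_conf r q hq κ hκ a (fun l => ((mem_conf.1 ha).1 l).1)
    (mem_conf.1 ha).2 s hs0 (fun l => hs _)
  rw [Finset.sum_congr rfl fun a ha => congrArg _ (h2 a ha)]
  simp only [mul_add, Finset.sum_add_distrib, Finset.mul_sum, Finset.sum_mul]
  congr 1
  · rw [Finset.sum_comm]
    refine Finset.sum_congr rfl fun i _ => ?_
    rw [Finset.sum_comm]
    refine Finset.sum_congr rfl fun m _ => Finset.sum_congr rfl fun a _ => ?_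
    rw [Finset.prod_mul_distrib (f := fun l : Fin r => ξ l ^ a l), Nat.cast_zero, add_zero]
    ring
  · rw [Finset.sum_comm]
    refine Finset.sum_congr rfl fun j _ => ?_
    rw [Finset.sum_comm]
    refine Finset.sum_congr rfl fun i _ => ?_
    rw [Finset.sum_comm]
    refine Finset.sum_congr rfl fun m _ => ?_
    rw [Finset.sum_comm]
    refine Finset.sum_congr rfl fun mm _ => Finset.sum_congr rfl fun a _ => ?_
    rw [← Finset.mul_prod_erase univ (fun l : Fin r => ξ l ^ a l) (Finset.mem_univ j),
      ← Finset.mul_prod_erase univ (fun l : Fin r => phiT κ ξ (extF r mm) (q + κ j - i - m - 1) j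
          (fun _ => 1) (a j) l (a l)) (Finset.mem_univ j)]
    have e : ∏ l ∈ univ.erase j, phiT κ ξ (extF r mm) (q + κ j - i - m - 1) j
          (fun _ => 1) (a j) l (a l) = (∏ l ∈ univ.erase j, ξ l ^ a l) *
          ∏ l ∈ univ.erase j, ((-1) ^ mm l * (Nat.choose (mm l + κ l - 1) (κ l - 1) : ℂ) *
          ((a l - a j : ℂ) ^ (κ l + mm l))⁻¹) := by
      rw [← Finset.prod_mul_distrib]
      refine Finset.prod_congr rfl fun l hl => ?_
      rw [phiT, if_neg (fun h => Finset.ne_of_mem_erase hl (Fin.ext h)), extF_fin]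
    rw [e, phiT, if_pos rfl]
    ring

lemma finite_identity (r q : ℕ) (hq : 0 < q) (κ : ℕ → ℕ) (hκ : ∀ l < r, 0 < κ l) (ξ : ℕ → ℂ)
    (X : ℂ) (N : ℕ) :
    (∑ n ∈ Ioc 0 N, X ^ n * PP r q κ ξ ((n : ℂ) - 1 / 2) N) +
      (∑ n ∈ range (N + 1), X⁻¹ ^ n * PP r q κ ξ (-(n : ℂ) - 1 / 2) N) =
    (∑ i ∈ range q, ∑ m ∈ Finset.Nat.antidiagonalTuple r (q - 1 - i),
      (∏ l : Fin r, (-1) ^ m l * (Nat.choose (m l + κ l - 1) (κ l - 1) : ℂ)) *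
        ES r (gterm 0 (fun l => κ l + extF r m l) ξ) 0 N * Wf X N i 0)
    + ∑ j : Fin r, ∑ i ∈ range (κ j), ∑ m ∈ range (κ j - i),
      ∑ mm ∈ (Finset.Nat.antidiagonalTuple r m).filter (fun mm => mm j = 0),
        ((-1) ^ (κ j - 1 - i - m) * (Nat.choose (q + κ j - m - i - 2) (q - 1) : ℂ)) *
          Dsum r κ ξ (extF r mm) (q + κ j - i - m - 1) j (Wf X N i) N := by
  have hs : ∀ (z : ℤ) (a : ℕ), (z : ℂ) - 1 / 2 + a ≠ 0 := by
    intro z a h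
    have h2 : ((2 * (z + a) : ℤ) : ℂ) = ((1 : ℤ) : ℂ) := by
      push_cast
      linear_combination 2 * h
    have h3 : 2 * (z + a) = 1 := by exact_mod_cast h2
    omega
  have hs1 : ∀ (n a : ℕ), (n : ℂ) - 1 / 2 + a ≠ 0 := fun n a => by simpa using hs n a
  have hs2 : ∀ (n a : ℕ), -(n : ℂ) - 1 / 2 + a ≠ 0 := fun n a => by simpa using hs (-n) a
  simp only [PP_eq r q hq κ hκ ξ _ N (hs1 _), PP_eq r q hq κ hκ ξ _ N (hs2 _)]
  simp only [mul_add, Finset.sum_add_distrib]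
  rw [add_add_add_comm]
  have hc : ∀ (i : ℕ) (m : Fin r → ℕ), (∑ a ∈ conf r 0 N, ∏ l : Fin r, ξ l ^ a l *
        ((-1) ^ m l * (Nat.choose (m l + κ l - 1) (κ l - 1) : ℂ) *
        ((a l : ℂ) ^ (κ l + m l))⁻¹)) =
      (∏ l : Fin r, (-1) ^ m l * (Nat.choose (m l + κ l - 1) (κ l - 1) : ℂ)) *
        ES r (gterm 0 (fun l => κ l + extF r m l) ξ) 0 N := by
    intro i m
    rw [← conf_sum, Finset.mul_sum]
    refine Finset.sum_congr rfl fun a _ => ?_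
    rw [← Finset.prod_mul_distrib]
    refine Finset.prod_congr rfl fun l _ => ?_
    rw [gterm, extF_fin, Complex.ofReal_zero, sub_zero]
    ring
  have hd : ∀ (j : Fin r) (i e : ℕ) (mm : Fin r → ℕ),
      Dsum r κ ξ (extF r mm) e j (Wf X N i) N =
      ∑ a ∈ conf r 0 N, (∏ l : Fin r, phiT κ ξ (extF r mm) e j
          (fun _ => 1) (a j) l (a l)) * Wf X N i (a j) := by
    intro j i e mm
    rw [Dsum, ← conf_sum_at r j j.isLt]
    refine Finset.sum_congr rfl fun a _ => ?_
    rw [← Finset.mul_prod_erase univ _ (Finset.mem_univ j),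
      ← Finset.mul_prod_erase univ _ (Finset.mem_univ j)]
    have e : ∏ l ∈ univ.erase j, phiT κ ξ (extF r mm) e j (Wf X N i) (a j) l (a l) =
        ∏ l ∈ univ.erase j, phiT κ ξ (extF r mm) e j (fun _ => 1) (a j) l (a l) := by
      refine Finset.prod_congr rfl fun l hl => ?_
      rw [phiT, phiT, if_neg (fun h => Finset.ne_of_mem_erase hl (Fin.ext h)),
        if_neg (fun h => Finset.ne_of_mem_erase hl (Fin.ext h))]
    rw [Fin.eta, e, phiT, phiT, if_pos rfl, if_pos rfl]
    ring
  congr 1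
  · simp only [Finset.mul_sum]
    rw [Finset.sum_comm, Finset.sum_comm (s := range (N + 1)), ← Finset.sum_add_distrib]
    refine Finset.sum_congr rfl fun i _ => ?_
    rw [Finset.sum_comm, Finset.sum_comm (s := range (N + 1)), ← Finset.sum_add_distrib]
    refine Finset.sum_congr rfl fun m _ => ?_
    rw [hc i m, Wf, mul_add, Finset.mul_sum, Finset.mul_sum]
    congr 1 <;> exact Finset.sum_congr rfl fun n _ => by ring
  · simp only [Finset.mul_sum, hd]
    rw [Finset.sum_comm, Finset.sum_comm (s := range (N + 1)), ← Finset.sum_add_distrib]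
    refine Finset.sum_congr rfl fun j _ => ?_
    rw [Finset.sum_comm, Finset.sum_comm (s := range (N + 1)), ← Finset.sum_add_distrib]
    refine Finset.sum_congr rfl fun i _ => ?_
    rw [Finset.sum_comm, Finset.sum_comm (s := range (N + 1)), ← Finset.sum_add_distrib]
    refine Finset.sum_congr rfl fun m _ => ?_
    rw [Finset.sum_comm, Finset.sum_comm (s := range (N + 1)), ← Finset.sum_add_distrib]
    refine Finset.sum_congr rfl fun mm _ => ?_
    rw [Finset.sum_comm, Finset.sum_comm (s := range (N + 1)), ← Finset.sum_add_distrib]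
    refine Finset.sum_congr rfl fun a _ => ?_
    rw [Wf, mul_add, mul_add, Finset.mul_sum, Finset.mul_sum, Finset.mul_sum, Finset.mul_sum]
    congr 1 <;> exact Finset.sum_congr rfl fun n _ => by ring

/-! ### Limits -/

lemma neg_pow_inv' (z : ℂ) (n : ℕ) : ((-z) ^ n)⁻¹ = (-1) ^ n * (z ^ n)⁻¹ := by
  rw [neg_pow, mul_inv, ← inv_pow]; norm_num

lemma pow_sub_inv (z : ℂ) (hz : z ≠ 0) {a b : ℕ} (h : a ≤ b) : z ^ (b - a) = z ^ b * z⁻¹ ^ a := by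
  rw [pow_sub₀ z hz h, inv_pow]

lemma conv_gen {β : ℝ} (hβ : 0 ≤ β ∧ β ≤ 1 / 2) (n : ℕ) (K : ℕ → ℕ) (Y : ℕ → ℂ)
    (hG : Good (n + 1) K Y) (U : ℂ)
    (hU : Tendsto (fun N => ES (n + 1) (gterm β K Y) 0 N) atTop (nhds U))
    (S : ℕ → ℕ → ℂ) (T : ℂ) (D : ℝ)
    (hS : ∀ N a, 1 ≤ a → a ≤ N → ‖S N a - T‖ ≤ D * wt (N + 1 - a)) :
    Tendsto (fun N => ∑ a ∈ Ioc 0 N, (ES n (gterm β K Y) 0 (a - 1) * gterm β K Y n a) * S N a)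
      atTop (nhds (U * T)) := by
  obtain ⟨hk, hx, -⟩ := hG
  obtain ⟨C, hC, hb⟩ := ES_bound hβ n K Y (fun l hl => hk l (by omega)) (fun l hl => hx l (by omega))
  refine conv_tendsto _ S U T (C * 2 ^ K n) D (by positivity) ?_ ?_ hS
  · intro a ha
    rw [norm_mul]
    have h1 := hb 0 (a - 1) a ha (by omega)
    have h2 := gterm_norm_le hβ K Y n a 1 (hx n (by omega)) ha (hk n (by omega))
    refine (mul_le_mul h1 h2 (norm_nonneg _) ?_).trans (le_of_eq ?_)
    · have := wt_nonneg a; positivity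
    · have : (a : ℝ) ≠ 0 := by positivity
      field_simp
  · simpa only [ES_last] using hU

lemma limA (r : ℕ) (k : ℕ → ℕ) (x : ℕ → ℂ) (hk : ∀ l ≤ r, 0 < k l) (hx : ∀ l ≤ r, ‖x l‖ = 1)
    (hr : ¬(k r = 1 ∧ x r = 1)) (X : ℂ) (hX : X = ∏ i ∈ range (r + 1), x i) :
    Tendsto (fun N : ℕ => ∑ n ∈ Ioc 0 N, X ^ n *
      PP r (k 0) (fun l => k (l + 1)) (fun l => x (l + 1)) ((n : ℂ) - 1 / 2) N) atTop
      (nhds (tval (List.ofFn fun i : Fin (r + 1) => (k i.val, x i.val)))) := by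
  set κ : ℕ → ℕ := fun l => k (l + 1) with hκ
  set ξ : ℕ → ℂ := fun l => x (l + 1) with hξ
  have hβ : (0 : ℝ) ≤ 1 / 2 ∧ (1 / 2 : ℝ) ≤ 1 / 2 := by norm_num
  have hG : Good (r + 1) k x := ⟨fun l hl => hk l (by omega), fun l hl => hx l (by omega),
    fun l hl => by obtain rfl : r = l := by omega
                   exact hr⟩
  have hG' : Good r κ ξ := ⟨fun l hl => hk _ (by omega), fun l hl => hx _ (by omega),
    fun l hl => by subst hl; exact hr⟩
  have h1 := (tval_spec (r + 1) k x hG (List.ofFn fun i : Fin (r + 1) => (k i.val, x i.val))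
    (by simp) (fun l h => List.getElem_ofFn h)).1
  obtain ⟨C, hC, hrate⟩ := ES_rate hβ r κ ξ hG'
  have key : ∀ N n : ℕ, X ^ n * PP r (k 0) κ ξ ((n : ℂ) - 1 / 2) N =
      gterm (1 / 2) k x 0 n * ES r (gterm (1 / 2) κ ξ) n (N + n) := by
    intro N n
    have e1 := ES_shift r (gterm (1 / 2) κ ξ) 0 N n
    rw [zero_add] at e1
    have e2 : ES r (fun l a => gterm (1 / 2) κ ξ l (a + n)) 0 N =
        ES r (fun l a => ξ l ^ n * (ξ l ^ a * (((n : ℂ) - 1 / 2 + a) ^ κ l)⁻¹)) 0 N := by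
      refine ES_congr _ _ _ _ _ fun l _ a _ _ => ?_
      have h : ((a + n : ℕ) : ℂ) - ((1 / 2 : ℝ) : ℂ) = (n : ℂ) - 1 / 2 + a := by push_cast; ring
      simp only [gterm, h]
      rw [pow_add]; ring
    rw [e1, e2, ES_smul, PP, gterm, hX, Finset.prod_range_succ', mul_pow, Finset.prod_pow]
    have h : (n : ℂ) - ((1 / 2 : ℝ) : ℂ) = (n : ℂ) - 1 / 2 := by push_cast; ring
    rw [h]
    simp only [hξ]
    ring
  have h2 : Tendsto (fun N : ℕ => ∑ n ∈ Ioc 0 N, gterm (1 / 2) k x 0 n *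
      (ES r (gterm (1 / 2) κ ξ) n (N + n) - ES r (gterm (1 / 2) κ ξ) n N)) atTop (nhds 0) := by
    have h3 := hH_wt_tendsto.const_mul (2 ^ k 0 * C)
    rw [mul_zero] at h3
    refine squeeze_zero_norm' ?_ h3
    filter_upwards [eventually_ge_atTop 1] with N hN
    refine (norm_sum_le _ _).trans ?_
    rw [hH, Finset.sum_mul, Finset.mul_sum]
    refine Finset.sum_le_sum fun n hn => ?_
    rw [Finset.mem_Ioc] at hn
    rw [norm_mul]
    have h4 := gterm_norm_le hβ k x 0 n 1 (hx 0 (by omega)) hn.1 (hk 0 (by omega))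
    have h5 := (hrate n N (N + n) hn.2 (by omega)).trans
      (mul_le_mul_of_nonneg_left (wt_anti hN (Nat.le_succ N)) hC)
    refine (mul_le_mul h4 h5 (norm_nonneg _) (by positivity)).trans (le_of_eq ?_)
    ring
  have h3 := h1.add h2
  rw [add_zero] at h3
  refine h3.congr fun N => ?_
  rw [ES_succ, ← Finset.sum_add_distrib]
  refine Finset.sum_congr rfl fun n _ => ?_
  rw [key]
  change gterm (1 / 2) k x 0 n * ES r (gterm (1 / 2) κ ξ) n N + _ = _
  ring

lemma limB (r : ℕ) (k : ℕ → ℕ) (x : ℕ → ℂ) (hk : ∀ l ≤ r, 0 < k l) (hx : ∀ l ≤ r, ‖x l‖ = 1)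
    (h0 : ¬(k 0 = 1 ∧ x 0 = 1))
    (hr : ¬(k r = 1 ∧ x r = 1)) (X : ℂ) (hX : X = ∏ i ∈ range (r + 1), x i) :
    Tendsto (fun N : ℕ => ∑ n ∈ range (N + 1), X⁻¹ ^ n *
      PP r (k 0) (fun l => k (l + 1)) (fun l => x (l + 1)) (-(n : ℂ) - 1 / 2) N) atTop
      (nhds (∑ j ∈ range (r + 1), (-1 : ℂ) ^ (∑ i ∈ range (j + 1), k i) *
        (∏ i ∈ range (j + 1), x i) *
        (tval (List.ofFn fun t : Fin (j + 1) => (k (j - t.val), (x (j - t.val))⁻¹)) *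
        tval (List.ofFn fun t : Fin (r - j) => (k (j + 1 + t.val), x (j + 1 + t.val)))))) := by
  have hβ : (0 : ℝ) ≤ 1 / 2 ∧ (1 / 2 : ℝ) ≤ 1 / 2 := by norm_num
  have hx0 : ∀ l ≤ r, x l ≠ 0 := fun l hl h => by have := hx l hl; rw [h] at this; simp at this
  have key : ∀ N n : ℕ, n ≤ N → X⁻¹ ^ n *
      PP r (k 0) (fun l => k (l + 1)) (fun l => x (l + 1)) (-(n : ℂ) - 1 / 2) N =
      ∑ j ∈ range (r + 1), (-1 : ℂ) ^ (∑ i ∈ range (j + 1), k i) *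
        (∏ i ∈ range (j + 1), x i) *
        ((ES j (gterm (1 / 2) (fun l => k (j - l)) (fun l => (x (j - l))⁻¹)) 0 (n + 1 - 1) *
          gterm (1 / 2) (fun l => k (j - l)) (fun l => (x (j - l))⁻¹) j (n + 1)) *
          ES (r - j) (gterm (1 / 2) (fun l => k (j + 1 + l)) (fun l => x (j + 1 + l))) 0
            (N + 1 - (n + 1))) := by
    intro N n hn
    rw [PP, ES_split r _ 0 n N (Nat.zero_le _) hn, Finset.mul_sum, Finset.mul_sum]
    refine Finset.sum_congr rfl fun j hj => ?_
    rw [Finset.mem_range] at hj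
    rw [ES_reflect j _ 0 n (Nat.zero_le _), Nat.sub_zero]
    have e1 : ES j (fun l a => x (j - 1 - l + 1) ^ (n + 1 - a) *
        ((-(n : ℂ) - 1 / 2 + ((n + 1 - a : ℕ) : ℂ)) ^ k (j - 1 - l + 1))⁻¹) 0 n =
        ES j (fun l a => ((x (j - 1 - l + 1)) ^ (n + 1) * (-1) ^ k (j - 1 - l + 1)) *
          gterm (1 / 2) (fun l => k (j - l)) (fun l => (x (j - l))⁻¹) l a) 0 n := by
      refine ES_congr _ _ _ _ _ fun l hl a ha ha' => ?_
      have h1 : -(n : ℂ) - 1 / 2 + ((n + 1 - a : ℕ) : ℂ) = -((a : ℂ) - ((1 / 2 : ℝ) : ℂ)) := by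
        rw [Nat.cast_sub (by omega)]; push_cast; ring
      rw [h1, neg_pow_inv', gterm, show j - 1 - l + 1 = j - l by omega,
        pow_sub_inv _ (hx0 _ (by omega)) (by omega)]
      ring
    have e2 : ES (r - j) (fun l a => x (j + l + 1) ^ a *
        ((-(n : ℂ) - 1 / 2 + (a : ℂ)) ^ k (j + l + 1))⁻¹) n N =
        ES (r - j) (fun l a => x (j + 1 + l) ^ n *
          gterm (1 / 2) (fun l => k (j + 1 + l)) (fun l => x (j + 1 + l)) l a) 0 (N - n) := by
      have h2 := ES_shift (r - j) (fun l a => x (j + l + 1) ^ a *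
        ((-(n : ℂ) - 1 / 2 + (a : ℂ)) ^ k (j + l + 1))⁻¹) 0 (N - n) n
      rw [zero_add, Nat.sub_add_cancel hn] at h2
      rw [h2]
      refine ES_congr _ _ _ _ _ fun l hl a ha ha' => ?_
      have h1 : -(n : ℂ) - 1 / 2 + ((a + n : ℕ) : ℂ) = ((a : ℂ) - ((1 / 2 : ℝ) : ℂ)) := by
        push_cast; ring
      rw [h1, gterm, show j + l + 1 = j + 1 + l by omega, pow_add]
      ring
    rw [e1, e2, ES_smul, ES_smul, Finset.prod_mul_distrib, Finset.prod_pow, Finset.prod_pow,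
      Finset.prod_range_reflect (fun l => x (l + 1)) j,
      Finset.prod_range_reflect (fun l => (-1 : ℂ) ^ k (l + 1)) j, Finset.prod_pow_eq_pow_sum]
    have e3 : -(n : ℂ) - 1 / 2 = -(((n + 1 : ℕ) : ℂ) - ((1 / 2 : ℝ) : ℂ)) := by push_cast; ring
    have e4 : X = x 0 * (∏ l ∈ range j, x (l + 1)) * ∏ l ∈ range (r - j), x (j + 1 + l) := by
      rw [hX, show r + 1 = (j + 1) + (r - j) by omega, Finset.prod_range_add,
        Finset.prod_range_succ' _ j]
      ring
    rw [e3, neg_pow_inv', Finset.sum_range_succ' _ j, Finset.prod_range_succ' _ j, e4, gterm,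
      Nat.sub_self, show N + 1 - (n + 1) = N - n by omega, show n + 1 - 1 = n by omega, mul_inv,
      mul_inv, mul_pow, mul_pow, pow_add (-1 : ℂ)]
    have hA : (∏ l ∈ range j, x (l + 1)) ≠ 0 := Finset.prod_ne_zero_iff.2 fun l hl =>
      hx0 _ (by rw [Finset.mem_range] at hl; omega)
    have hB : (∏ l ∈ range (r - j), x (j + 1 + l)) ≠ 0 := Finset.prod_ne_zero_iff.2 fun l hl =>
      hx0 _ (by rw [Finset.mem_range] at hl; omega)
    have h00 := hx0 0 (by omega)
    generalize (∏ l ∈ range j, x (l + 1)) = A at *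
    generalize (∏ l ∈ range (r - j), x (j + 1 + l)) = B at *
    have hA' : A⁻¹ ^ n * A ^ (n + 1) = A := by
      rw [pow_succ, ← mul_assoc, ← mul_pow, inv_mul_cancel₀ hA, one_pow, one_mul]
    have hB' : B⁻¹ ^ n * B ^ n = 1 := by rw [← mul_pow, inv_mul_cancel₀ hB, one_pow]
    have h0' : (x 0)⁻¹ ^ n = x 0 * (x 0)⁻¹ ^ (n + 1) := by
      rw [pow_succ, mul_comm, mul_assoc, inv_mul_cancel₀ h00, mul_one]
    rw [h0', div_eq_mul_inv]
    generalize ES j _ _ _ = E1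
    generalize ES (r - j) _ _ _ = E2
    calc _ = (x 0 * (x 0)⁻¹ ^ (n + 1)) * (A⁻¹ ^ n * A ^ (n + 1)) * (B⁻¹ ^ n * B ^ n) *
          ((-1) ^ k 0 * ((((n + 1 : ℕ) : ℂ) - ((1 / 2 : ℝ) : ℂ)) ^ k 0)⁻¹) * (-1) ^ (∑ i ∈ range j, k (i + 1)) * E1 * E2 := by ring
      _ = _ := by rw [hA', hB']; ring
  have hlim : ∀ j ∈ range (r + 1), Tendsto (fun N : ℕ => (-1 : ℂ) ^ (∑ i ∈ range (j + 1), k i) *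
        (∏ i ∈ range (j + 1), x i) * ∑ p ∈ Ioc 0 (N + 1),
        ((ES j (gterm (1 / 2) (fun l => k (j - l)) (fun l => (x (j - l))⁻¹)) 0 (p - 1) *
          gterm (1 / 2) (fun l => k (j - l)) (fun l => (x (j - l))⁻¹) j p) *
          ES (r - j) (gterm (1 / 2) (fun l => k (j + 1 + l)) (fun l => x (j + 1 + l))) 0
            (N + 1 - p))) atTop (nhds ((-1 : ℂ) ^ (∑ i ∈ range (j + 1), k i) *
        (∏ i ∈ range (j + 1), x i) *
        (tval (List.ofFn fun t : Fin (j + 1) => (k (j - t.val), (x (j - t.val))⁻¹)) *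
        tval (List.ofFn fun t : Fin (r - j) => (k (j + 1 + t.val), x (j + 1 + t.val)))))) := by
    intro j hj
    rw [Finset.mem_range] at hj
    refine Tendsto.const_mul _ ?_
    have hG1 : Good (j + 1) (fun l => k (j - l)) (fun l => (x (j - l))⁻¹) :=
      ⟨fun l hl => hk _ (by omega), fun l hl => by
          simp only [norm_inv]; rw [hx _ (by omega), inv_one],
        fun l hl => by
          obtain rfl : j = l := by omega
          simpa using h0⟩
    have hG2 : Good (r - j) (fun l => k (j + 1 + l)) (fun l => x (j + 1 + l)) :=
      ⟨fun l hl => hk _ (by omega), fun l hl => hx _ (by omega), fun l hl => by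
        have : j + 1 + l = r := by omega
        simp only [this]; exact hr⟩
    have t1 := (tval_spec (j + 1) _ _ hG1
      (List.ofFn fun t : Fin (j + 1) => (k (j - t.val), (x (j - t.val))⁻¹))
      (by simp) (fun l h => List.getElem_ofFn h)).1
    obtain ⟨-, D, hD, t2⟩ := tval_spec (r - j) _ _ hG2
      (List.ofFn fun t : Fin (r - j) => (k (j + 1 + t.val), x (j + 1 + t.val)))
      (by simp) (fun l h => List.getElem_ofFn h)
    have t3 := conv_gen hβ j _ _ hG1 _ t1 (fun N p => ES (r - j) (gterm (1 / 2)
      (fun l => k (j + 1 + l)) (fun l => x (j + 1 + l))) 0 (N - p)) _ D (fun N a ha haN => by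
        have := t2 (N - a)
        rwa [show N - a + 1 = N + 1 - a by omega] at this)
    exact t3.comp (tendsto_add_atTop_nat 1)
  refine (tendsto_finsetSum _ hlim).congr fun N => ?_
  simp only [Finset.mul_sum]
  rw [Finset.sum_comm, sum_Ioc_range]
  refine Finset.sum_congr rfl fun n hn => ?_
  rw [key N n (by rw [Finset.mem_range] at hn; omega)]

/-- The value of the depth-one combination. -/
noncomputable def thatF (i : ℕ) (X : ℂ) : ℂ :=
  (-1 : ℂ) ^ i * tval1 (i + 1) X⁻¹ - X⁻¹ * tval1 (i + 1) X

lemma limC (r : ℕ) (κ : ℕ → ℕ) (ξ : ℕ → ℂ) (hκ : ∀ l < r, 0 < κ l) (hξ : ∀ l < r, ‖ξ l‖ = 1)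
    (hr : ∀ l, r = l + 1 → ¬(κ l = 1 ∧ ξ l = 1)) (X : ℂ) (hX : ‖X‖ = 1) (hX1 : X ≠ 1)
    (m : Fin r → ℕ) (i : ℕ) :
    Tendsto (fun N : ℕ => ES r (gterm 0 (fun l => κ l + extF r m l) ξ) 0 N * Wf X N i 0) atTop
      (nhds (cmzv (List.ofFn fun l : Fin r => (κ l + m l, ξ l)) * (-X * thatF i X))) := by
  have hX0 : X ≠ 0 := by rintro rfl; simp at hX
  refine Tendsto.mul ?_ ?_
  · refine (cmzv_spec r _ _ ⟨fun l hl => Nat.add_pos_left (hκ l hl) _, hξ, fun l hl h => ?_⟩ _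
      (by simp) (fun l h => ?_)).1
    · refine hr l hl ⟨?_, h.2⟩
      have h1 := h.1
      have h2 := hκ l (by omega)
      omega
    · rw [List.getElem_ofFn, extF, dif_pos (by simpa using h)]
  · obtain ⟨C, hC, h⟩ := Vf_rate X hX hX1 i
    rw [tendsto_iff_norm_sub_tendsto_zero]
    have h2 := (wt_tendsto.comp (tendsto_add_atTop_nat 1)).const_mul C
    rw [mul_zero] at h2
    refine squeeze_zero (fun _ => norm_nonneg _) (fun N => ?_) h2
    rw [Wf_eq X hX0 N i 0 (Nat.zero_le _), pow_zero, one_mul]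
    exact h N 0 (Nat.zero_le _)

lemma limD (r : ℕ) (κ : ℕ → ℕ) (ξ : ℕ → ℂ) (hκ : ∀ l < r, 0 < κ l) (hξ : ∀ l < r, ‖ξ l‖ = 1)
    (hr : ∀ l, r = l + 1 → ¬(κ l = 1 ∧ ξ l = 1)) (x0 : ℂ) (hx0 : ‖x0‖ = 1) (X : ℂ)
    (hX : X = x0 * ∏ l ∈ range r, ξ l) (hX1 : X ≠ 1)
    (mm : ℕ → ℕ) (i j e : ℕ) (hj : j < r) (he : 0 < e) (he1 : ¬(e = 1 ∧ x0 = 1))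
    (L1 L2 : List (ℕ × ℂ)) (hL1 : L1.length = j + 1)
    (hL1a : ∀ l (h : l < L1.length), L1[l] =
      (if l < j then κ (j - 1 - l) + mm (j - 1 - l) else e,
        if l < j then (ξ (j - 1 - l))⁻¹ else x0⁻¹))
    (hL2 : L2.length = r - (j + 1))
    (hL2a : ∀ l (h : l < L2.length), L2[l] = (κ (j + 1 + l) + mm (j + 1 + l), ξ (j + 1 + l))) :
    Tendsto (fun N : ℕ => Dsum r κ ξ mm e j (Wf X N i) N) atTop
      (nhds (((∏ l ∈ range j, ((-1 : ℂ) ^ κ l * (Nat.choose (mm l + κ l - 1) (κ l - 1) : ℂ))) *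
        (-1) ^ e * ∏ l ∈ range (r - (j + 1)), ((-1 : ℂ) ^ mm (j + 1 + l) *
          (Nat.choose (mm (j + 1 + l) + κ (j + 1 + l) - 1) (κ (j + 1 + l) - 1) : ℂ))) *
        (cmzv L1 * (cmzv L2 * (-X * thatF i X))))) := by
  have hβ : (0 : ℝ) ≤ 0 ∧ (0 : ℝ) ≤ 1 / 2 := by norm_num
  have hξ0 : ∀ l < r, ξ l ≠ 0 := fun l hl h => by have := hξ l hl; rw [h] at this; simp at this
  have hx00 : x0 ≠ 0 := by rintro rfl; simp at hx0
  have hXn : ‖X‖ = 1 := by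
    rw [hX, norm_mul, hx0, norm_prod, one_mul]
    exact Finset.prod_eq_one fun l hl => hξ l (Finset.mem_range.1 hl)
  have hX0 : X ≠ 0 := by intro h; rw [h] at hXn; simp at hXn
  set K : ℕ → ℕ := fun l => if l < j then κ (j - 1 - l) + mm (j - 1 - l) else e with hK
  set Y : ℕ → ℂ := fun l => if l < j then (ξ (j - 1 - l))⁻¹ else x0⁻¹ with hY
  have hG1 : Good (j + 1) K Y := by
    refine ⟨fun l hl => ?_, fun l hl => ?_, fun l hl h => ?_⟩
    · simp only [hK]; split_ifs
      · exact Nat.add_pos_left (hκ _ (by omega)) _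
      · exact he
    · simp only [hY]; split_ifs
      · rw [norm_inv, hξ _ (by omega), inv_one]
      · rw [norm_inv, hx0, inv_one]
    · obtain rfl : j = l := by omega
      simp only [hK, hY, lt_irrefl, if_false, inv_eq_one] at h
      exact he1 h
  have hG2 : Good (r - (j + 1)) (fun l => κ (j + 1 + l) + mm (j + 1 + l))
      (fun l => ξ (j + 1 + l)) := by
    refine ⟨fun l hl => Nat.add_pos_left (hκ _ (by omega)) _, fun l hl => hξ _ (by omega),
      fun l hl h => hr (j + 1 + l) (by omega) ⟨?_, h.2⟩⟩
    have h1 := h.1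
    have h2 := hκ (j + 1 + l) (by omega)
    simp only at h1
    omega
  obtain ⟨t1, -⟩ := cmzv_spec (j + 1) K Y hG1 L1 hL1 hL1a
  obtain ⟨-, C2, hC2, t2⟩ := cmzv_spec _ _ _ hG2 L2 hL2 hL2a
  obtain ⟨C3, hC3, t3⟩ := Vf_rate X hXn hX1 i
  have hS : ∀ N a, 1 ≤ a → a ≤ N → ‖ES (r - (j + 1)) (gterm 0
      (fun l => κ (j + 1 + l) + mm (j + 1 + l)) (fun l => ξ (j + 1 + l))) 0 (N - a) * Vf X N i a -
      cmzv L2 * (-X * thatF i X)‖ ≤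
      (C2 * (C3 + ‖-X * thatF i X‖) + ‖cmzv L2‖ * C3) * wt (N + 1 - a) := by
    intro N a ha haN
    have s2 := t2 (N - a)
    rw [show N - a + 1 = N + 1 - a by omega] at s2
    have s3 : ‖Vf X N i a - (-X * thatF i X)‖ ≤ C3 * wt (N + 1 - a) := t3 N a haN
    generalize ES (r - (j + 1)) _ _ _ = E at *
    generalize Vf X N i a = V at *
    generalize -X * thatF i X = T at *
    have hw : wt (N + 1 - a) ≤ 1 := wt_le_one (by omega)
    have hw0 := wt_nonneg (N + 1 - a)
    have hV : ‖V‖ ≤ C3 + ‖T‖ := by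
      calc ‖V‖ = ‖(V - T) + T‖ := by rw [sub_add_cancel]
        _ ≤ ‖V - T‖ + ‖T‖ := norm_add_le _ _
        _ ≤ C3 + ‖T‖ := by
          have := mul_le_mul_of_nonneg_left hw hC3
          linarith
    calc ‖E * V - cmzv L2 * T‖ = ‖(E - cmzv L2) * V + cmzv L2 * (V - T)‖ := by congr 1; ring
      _ ≤ ‖E - cmzv L2‖ * ‖V‖ + ‖cmzv L2‖ * ‖V - T‖ := by
        refine (norm_add_le _ _).trans ?_
        rw [norm_mul, norm_mul]
      _ ≤ (C2 * wt (N + 1 - a)) * (C3 + ‖T‖) + ‖cmzv L2‖ * (C3 * wt (N + 1 - a)) := by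
        gcongr
      _ = _ := by ring
  have t4 := conv_gen hβ j K Y hG1 _ t1 _ _ _ hS
  refine (t4.const_mul _).congr fun N => ?_
  rw [Dsum, Finset.mul_sum]
  refine Finset.sum_congr rfl fun b hb => ?_
  rw [Finset.mem_Ioc] at hb
  have e1 : ES j (phiT κ ξ mm e j (Wf X N i) b) 0 (b - 1) =
      (∏ l ∈ range j, ξ l) ^ b * (∏ l ∈ range j, ((-1 : ℂ) ^ κ l *
        (Nat.choose (mm l + κ l - 1) (κ l - 1) : ℂ))) * ES j (gterm 0 K Y) 0 (b - 1) := by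
    rw [ES_reflect j _ 0 (b - 1) (Nat.zero_le _), Nat.sub_zero, Nat.sub_add_cancel hb.1]
    rw [← Finset.prod_pow, ← Finset.prod_mul_distrib, ← Finset.prod_range_reflect, ← ES_smul]
    refine ES_congr _ _ _ _ _ fun l hl a ha ha' => ?_
    have h1 : ((b - a : ℕ) : ℂ) - b = -(a : ℂ) := by
      rw [Nat.cast_sub (by omega)]; ring
    rw [phiT, if_neg (by omega), h1, neg_pow_inv', gterm,
        pow_sub_inv _ (hξ0 _ (by omega)) (by omega : a ≤ b)]
    simp only [hK, hY, if_pos hl, Complex.ofReal_zero, sub_zero]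
    have h2 : (-1 : ℂ) ^ mm (j - 1 - l) * (-1) ^ mm (j - 1 - l) = 1 := by
      rw [← mul_pow]; norm_num
    rw [pow_add (-1 : ℂ), div_eq_mul_inv]
    linear_combination (ξ (j - 1 - l) ^ b * (ξ (j - 1 - l))⁻¹ ^ a *
      ((mm (j - 1 - l) + κ (j - 1 - l) - 1).choose (κ (j - 1 - l) - 1) : ℂ) * (-1) ^ κ (j - 1 - l) *
      ((a : ℂ) ^ (κ (j - 1 - l) + mm (j - 1 - l)))⁻¹) * h2
  have e2 : ES (r - (j + 1)) (fun l => phiT κ ξ mm e j (Wf X N i) b (j + 1 + l)) b N =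
      (∏ l ∈ range (r - (j + 1)), ξ (j + 1 + l)) ^ b *
      (∏ l ∈ range (r - (j + 1)), ((-1 : ℂ) ^ mm (j + 1 + l) *
          (Nat.choose (mm (j + 1 + l) + κ (j + 1 + l) - 1) (κ (j + 1 + l) - 1) : ℂ))) *
      ES (r - (j + 1)) (gterm 0
      (fun l => κ (j + 1 + l) + mm (j + 1 + l)) (fun l => ξ (j + 1 + l))) 0 (N - b) := by
    have h2 := ES_shift (r - (j + 1)) (fun l => phiT κ ξ mm e j (Wf X N i) b (j + 1 + l)) 0 (N - b) b
    rw [zero_add, Nat.sub_add_cancel hb.2] at h2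
    rw [h2, ← Finset.prod_pow, ← Finset.prod_mul_distrib, ← ES_smul]
    refine ES_congr _ _ _ _ _ fun l hl a ha ha' => ?_
    have h1 : ((a + b : ℕ) : ℂ) - b = (a : ℂ) := by push_cast; ring
    simp only [phiT]
    rw [if_neg (by omega), h1, gterm, pow_add, Complex.ofReal_zero, sub_zero, div_eq_mul_inv]
    ring
  have e3 : phiT κ ξ mm e j (Wf X N i) b j b =
      (-1) ^ e * ξ j ^ b * (X⁻¹ ^ b * ((b : ℂ) ^ e)⁻¹) * Vf X N i b := by
    rw [phiT, if_pos rfl, neg_pow_inv', Wf_eq X hX0 N i b hb.2]; ring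
  have e4 : gterm 0 K Y j b = x0⁻¹ ^ b * ((b : ℂ) ^ e)⁻¹ := by
    simp only [gterm, hK, hY, lt_irrefl, if_false, Complex.ofReal_zero, sub_zero, div_eq_mul_inv]
  have e5 : X = x0 * ((∏ l ∈ range j, ξ l) * ξ j * ∏ l ∈ range (r - (j + 1)), ξ (j + 1 + l)) := by
    rw [hX, ← Finset.prod_range_succ, ← Finset.prod_range_add, Nat.add_sub_cancel' hj]
  have hP : ((∏ l ∈ range j, ξ l) * ξ j * ∏ l ∈ range (r - (j + 1)), ξ (j + 1 + l)) ≠ 0 := by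
    intro h; rw [h, mul_zero] at e5; exact hX0 e5
  have e6 : ((∏ l ∈ range j, ξ l) * ξ j * ∏ l ∈ range (r - (j + 1)), ξ (j + 1 + l)) ^ b * X⁻¹ ^ b =
      x0⁻¹ ^ b := by
    rw [e5, mul_inv, mul_comm x0⁻¹, ← mul_pow, ← mul_assoc, mul_inv_cancel₀ hP, one_mul]
  rw [e1, e2, e3, e4, ← e6, mul_pow, mul_pow]
  ring

lemma prod_erase_range (r : ℕ) (j : Fin r) (f : ℕ → ℂ) :
    ∏ l ∈ univ.erase j, f (l : Fin r) =
      (∏ l ∈ range j, f l) * ∏ l ∈ range (r - (j + 1)), f (j + 1 + l) := by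
  have hj := j.isLt
  have h1 : ∏ l ∈ univ.erase j, f (l : Fin r) = ∏ l : Fin r, if (l : ℕ) = j then 1 else f l := by
    rw [← Finset.mul_prod_erase univ _ (Finset.mem_univ j), if_pos rfl, one_mul]
    refine Finset.prod_congr rfl fun l hl => ?_
    rw [if_neg (fun h => Finset.ne_of_mem_erase hl (Fin.ext h))]
  rw [h1, Fin.prod_univ_eq_prod_range (fun l => if l = (j : ℕ) then 1 else f l) r,
    show range r = range ((j + 1) + (r - (j + 1))) by rw [Nat.add_sub_cancel' hj],
    Finset.prod_range_add, Finset.prod_range_succ, if_pos rfl, mul_one]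
  congr 1
  · refine Finset.prod_congr rfl fun l hl => ?_
    rw [Finset.mem_range] at hl; rw [if_neg (by omega)]
  · refine Finset.prod_congr rfl fun l hl => ?_
    rw [if_neg (by omega)]

lemma prod_gt_range (r : ℕ) (j : Fin r) (f : ℕ → ℂ) :
    ∏ l ∈ univ.filter (fun l => j < l), f (l : Fin r) =
      ∏ l ∈ range (r - (j + 1)), f (j + 1 + l) := by
  have hj := j.isLt
  rw [Finset.prod_filter, Finset.prod_congr rfl (g := fun l : Fin r => if (j : ℕ) < l then f l else 1)
    (fun l _ => by simp only [Fin.lt_def]),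
    Fin.prod_univ_eq_prod_range (fun l => if (j : ℕ) < l then f l else 1) r,
    show range r = range ((j + 1) + (r - (j + 1))) by rw [Nat.add_sub_cancel' hj],
    Finset.prod_range_add]
  have h1 : ∏ l ∈ range (j + 1), (if (j : ℕ) < l then f l else 1) = 1 :=
    Finset.prod_eq_one fun l hl => by rw [Finset.mem_range] at hl; rw [if_neg (by omega)]
  rw [h1, one_mul]
  refine Finset.prod_congr rfl fun l hl => ?_
  rw [if_pos (by omega)]
/-- Symmetry theorem for cyclotomic multiple t-values (Corollary `maincor-CMtVs`). -/
theorem symmetry_cmtv (r : ℕ) (k : ℕ → ℕ) (x : ℕ → ℂ)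
    (hk : ∀ i, i ≤ r → 0 < k i)
    (hx : ∀ i, i ≤ r → IsRootOfUnity (x i))
    (h0 : ¬(k 0 = 1 ∧ x 0 = 1)) (hr : ¬(k r = 1 ∧ x r = 1))
    (X : ℂ) (hX : X = ∏ i ∈ Finset.range (r + 1), x i) (hX1 : X ≠ 1) :
    X⁻¹ * tval (List.ofFn fun i : Fin (r + 1) => (k i.val, x i.val))
    + (∑ j : Fin (r + 1), (-1 : ℂ) ^ (∑ i ∈ Finset.range (j.val + 1), k i)
        * (∏ i ∈ Finset.Icc (j.val + 1) r, x i)⁻¹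
        * tval (List.ofFn fun t : Fin (r - j.val) => (k (j.val + 1 + t.val), x (j.val + 1 + t.val)))
        * tval (List.ofFn fun t : Fin (j.val + 1) => (k (j.val - t.val), (x (j.val - t.val))⁻¹)))
    + (∑ j ∈ Finset.range (k 0), ∑ m ∈ Finset.Nat.antidiagonalTuple r (k 0 - 1 - j),
        ((-1 : ℂ) ^ (k 0 - 1 - j)
            * ∏ l : Fin r, (Nat.choose (m l + k (l.val + 1) - 1) (k (l.val + 1) - 1) : ℂ))
          * ((-1 : ℂ) ^ j * tval1 (j + 1) X⁻¹ - X⁻¹ * tval1 (j + 1) X)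
          * cmzv (List.ofFn fun l : Fin r => (k (l.val + 1) + m l, x (l.val + 1))))
    + (∑ j : Fin r, ∑ i ∈ Finset.range (k (j.val + 1)),
        ∑ m ∈ Finset.range (k (j.val + 1) - i),
        ∑ mm ∈ (Finset.Nat.antidiagonalTuple r m).filter (fun mm => mm j = 0),
          (-1 : ℂ) ^ ((∑ t ∈ Finset.range (j.val + 1), k t)
              + ∑ l ∈ Finset.univ.filter (fun l => j < l), mm l)
          * (Nat.choose (k 0 + k (j.val + 1) - m - i - 2) (k 0 - 1) : ℂ)
          * (∏ l ∈ Finset.univ.erase j,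
              (Nat.choose (mm l + k (l.val + 1) - 1) (k (l.val + 1) - 1) : ℂ))
          * ((-1 : ℂ) ^ i * tval1 (i + 1) X⁻¹ - X⁻¹ * tval1 (i + 1) X)
          * cmzv (List.ofFn fun t : Fin (r - (j.val + 1)) =>
              (k (j.val + 2 + t.val) + mm ⟨j.val + 1 + t.val, by have := t.isLt; omega⟩,
                x (j.val + 2 + t.val)))
          * cmzv ((List.ofFn fun t : Fin j.val =>
              (k (j.val - t.val) + mm ⟨j.val - 1 - t.val, by have := t.isLt; have := j.isLt; omega⟩,
                (x (j.val - t.val))⁻¹))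
              ++ [(k 0 + k (j.val + 1) - i - m - 1, (x 0)⁻¹)]))
    = 0 := by
  have hxn : ∀ l ≤ r, ‖x l‖ = 1 := by
    intro l hl
    obtain ⟨n, hn, h⟩ := hx l hl
    exact Complex.norm_eq_one_of_pow_eq_one h (by omega)
  have hXn : ‖X‖ = 1 := by
    rw [hX, norm_prod]
    exact Finset.prod_eq_one fun l hl => hxn l (by rw [Finset.mem_range] at hl; omega)
  have hX0 : X ≠ 0 := by intro h; rw [h] at hXn; simp at hXn
  have hXs : X = x 0 * ∏ l ∈ range r, x (l + 1) := by
    rw [hX, Finset.prod_range_succ', mul_comm]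
  have hκ : ∀ l < r, 0 < k (l + 1) := fun l hl => hk _ (by omega)
  have hξ : ∀ l < r, ‖x (l + 1)‖ = 1 := fun l hl => hxn _ (by omega)
  have hr' : ∀ l, r = l + 1 → ¬(k (l + 1) = 1 ∧ x (l + 1) = 1) := by
    intro l hl; rw [← hl]; exact hr
  have hq := hk 0 (Nat.zero_le _)
  have tA := limA r k x hk hxn hr X hX
  have tB := limB r k x hk hxn h0 hr X hX
  have tC := tendsto_finsetSum (range (k 0)) fun i _ =>
    tendsto_finsetSum (Finset.Nat.antidiagonalTuple r (k 0 - 1 - i)) fun m _ =>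
      (limC r (fun l => k (l + 1)) (fun l => x (l + 1)) hκ hξ hr' X hXn hX1 m i).const_mul
        (∏ l : Fin r, (-1 : ℂ) ^ m l *
          (Nat.choose (m l + k (l + 1) - 1) (k (l + 1) - 1) : ℂ))
  have tD := tendsto_finsetSum (univ : Finset (Fin r)) fun j _ =>
    tendsto_finsetSum (range (k (j + 1))) fun i hi =>
    tendsto_finsetSum (range (k (j + 1) - i)) fun m hm =>
    tendsto_finsetSum ((Finset.Nat.antidiagonalTuple r m).filter (fun mm => mm j = 0))
      fun mm _ =>
      (limD r (fun l => k (l + 1)) (fun l => x (l + 1)) hκ hξ hr' (x 0) (hxn 0 (Nat.zero_le _)) X hXs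
        hX1 (extF r mm) i j (k 0 + k (j + 1) - i - m - 1) j.isLt
        (by rw [Finset.mem_range] at hi hm; omega)
        (fun h => h0 ⟨by rw [Finset.mem_range] at hi hm; omega, h.2⟩)
        ((List.ofFn fun t : Fin j.val =>
              (k (j.val - t.val) + mm ⟨j.val - 1 - t.val, by have := t.isLt; have := j.isLt; omega⟩,
                (x (j.val - t.val))⁻¹))
              ++ [(k 0 + k (j.val + 1) - i - m - 1, (x 0)⁻¹)])
        (List.ofFn fun t : Fin (r - (j.val + 1)) =>
              (k (j.val + 2 + t.val) + mm ⟨j.val + 1 + t.val, by have := t.isLt; omega⟩,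
                x (j.val + 2 + t.val)))
        (by simp)
        (fun l hl => by
          rw [List.getElem_append]
          simp only [List.length_ofFn, List.length_append, List.length_singleton] at hl ⊢
          split_ifs with h
          · rw [List.getElem_ofFn, extF, dif_pos (by have := j.isLt; omega)]
            simp only [show j.val - 1 - l + 1 = j.val - l by omega]
          · simp)
        (by simp)
        (fun l hl => by
          rw [List.length_ofFn] at hl
          rw [List.getElem_ofFn, extF, dif_pos (by omega)]
          simp only [show j.val + 1 + l + 1 = j.val + 2 + l by omega])).const_mul
        ((-1 : ℂ) ^ (k (j + 1) - 1 - i - m) *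
          (Nat.choose (k 0 + k (j + 1) - m - i - 2) (k 0 - 1) : ℂ))
  have hlim := tendsto_nhds_unique (tA.add tB) ((tC.add tD).congr fun N => by
      rw [finite_identity r (k 0) hq (fun l => k (l + 1)) hκ (fun l => x (l + 1)) X N]
      simp only [mul_assoc])
  have eB : (∑ j : Fin (r + 1), (-1 : ℂ) ^ (∑ i ∈ Finset.range (j.val + 1), k i)
        * (∏ i ∈ Finset.Icc (j.val + 1) r, x i)⁻¹
        * tval (List.ofFn fun t : Fin (r - j.val) => (k (j.val + 1 + t.val), x (j.val + 1 + t.val)))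
        * tval (List.ofFn fun t : Fin (j.val + 1) => (k (j.val - t.val), (x (j.val - t.val))⁻¹))) =
      X⁻¹ * ∑ j ∈ range (r + 1), (-1 : ℂ) ^ (∑ i ∈ range (j + 1), k i) *
        (∏ i ∈ range (j + 1), x i) *
        (tval (List.ofFn fun t : Fin (j + 1) => (k (j - t.val), (x (j - t.val))⁻¹)) *
        tval (List.ofFn fun t : Fin (r - j) => (k (j + 1 + t.val), x (j + 1 + t.val)))) := by
    rw [Finset.mul_sum, Finset.sum_range]
    refine Finset.sum_congr rfl fun j _ => ?_
    have hj := j.isLt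
    have e1 : X = (∏ i ∈ range (j.val + 1), x i) * ∏ i ∈ Finset.Icc (j.val + 1) r, x i := by
      rw [hX, Finset.range_eq_Ico, Finset.range_eq_Ico,
        ← Finset.prod_Ico_consecutive x (Nat.zero_le (j.val + 1)) (by omega : j.val + 1 ≤ r + 1)]
      rfl
    have e2 : (∏ i ∈ range (j.val + 1), x i) ≠ 0 := by
      intro h; rw [h, zero_mul] at e1; exact hX0 e1
    have e3 : (∏ i ∈ Finset.Icc (j.val + 1) r, x i)⁻¹ = X⁻¹ * ∏ i ∈ range (j.val + 1), x i := by
      rw [e1, mul_inv, mul_comm, ← mul_assoc, mul_inv_cancel₀ e2, one_mul]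
    rw [e3]; ring
  have eC : (∑ j ∈ Finset.range (k 0), ∑ m ∈ Finset.Nat.antidiagonalTuple r (k 0 - 1 - j),
        ((-1 : ℂ) ^ (k 0 - 1 - j)
            * ∏ l : Fin r, (Nat.choose (m l + k (l.val + 1) - 1) (k (l.val + 1) - 1) : ℂ))
          * ((-1 : ℂ) ^ j * tval1 (j + 1) X⁻¹ - X⁻¹ * tval1 (j + 1) X)
          * cmzv (List.ofFn fun l : Fin r => (k (l.val + 1) + m l, x (l.val + 1)))) =
      -X⁻¹ * ∑ i ∈ range (k 0), ∑ m ∈ Finset.Nat.antidiagonalTuple r (k 0 - 1 - i),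
        (∏ l : Fin r, (-1 : ℂ) ^ m l *
          (Nat.choose (m l + k (l + 1) - 1) (k (l + 1) - 1) : ℂ)) *
        (cmzv (List.ofFn fun l : Fin r => (k (l + 1) + m l, x (l + 1))) * (-X * thatF i X)) := by
    rw [Finset.mul_sum]
    refine Finset.sum_congr rfl fun i _ => ?_
    rw [Finset.mul_sum]
    refine Finset.sum_congr rfl fun m hm => ?_
    rw [Finset.Nat.mem_antidiagonalTuple] at hm
    rw [Finset.prod_mul_distrib, Finset.prod_pow_eq_pow_sum, hm, thatF]
    generalize ((-1 : ℂ) ^ i * tval1 (i + 1) X⁻¹ - X⁻¹ * tval1 (i + 1) X) = T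
    field_simp
  have eD : (∑ j : Fin r, ∑ i ∈ Finset.range (k (j.val + 1)),
        ∑ m ∈ Finset.range (k (j.val + 1) - i),
        ∑ mm ∈ (Finset.Nat.antidiagonalTuple r m).filter (fun mm => mm j = 0),
          (-1 : ℂ) ^ ((∑ t ∈ Finset.range (j.val + 1), k t)
              + ∑ l ∈ Finset.univ.filter (fun l => j < l), mm l)
          * (Nat.choose (k 0 + k (j.val + 1) - m - i - 2) (k 0 - 1) : ℂ)
          * (∏ l ∈ Finset.univ.erase j,
              (Nat.choose (mm l + k (l.val + 1) - 1) (k (l.val + 1) - 1) : ℂ))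
          * ((-1 : ℂ) ^ i * tval1 (i + 1) X⁻¹ - X⁻¹ * tval1 (i + 1) X)
          * cmzv (List.ofFn fun t : Fin (r - (j.val + 1)) =>
              (k (j.val + 2 + t.val) + mm ⟨j.val + 1 + t.val, by have := t.isLt; omega⟩,
                x (j.val + 2 + t.val)))
          * cmzv ((List.ofFn fun t : Fin j.val =>
              (k (j.val - t.val) + mm ⟨j.val - 1 - t.val, by have := t.isLt; have := j.isLt; omega⟩,
                (x (j.val - t.val))⁻¹))
              ++ [(k 0 + k (j.val + 1) - i - m - 1, (x 0)⁻¹)])) =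
      -X⁻¹ * ∑ j : Fin r, ∑ i ∈ range (k (j.val + 1)), ∑ m ∈ range (k (j.val + 1) - i),
        ∑ mm ∈ (Finset.Nat.antidiagonalTuple r m).filter (fun mm => mm j = 0),
          ((-1 : ℂ) ^ (k (j + 1) - 1 - i - m) *
            (Nat.choose (k 0 + k (j + 1) - m - i - 2) (k 0 - 1) : ℂ)) *
          (((∏ l ∈ range j, ((-1 : ℂ) ^ k (l + 1) *
              (Nat.choose (extF r mm l + k (l + 1) - 1) (k (l + 1) - 1) : ℂ))) *
            (-1) ^ (k 0 + k (j + 1) - i - m - 1) *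
            ∏ l ∈ range (r - (j + 1)), ((-1 : ℂ) ^ extF r mm (j + 1 + l) *
              (Nat.choose (extF r mm (j + 1 + l) + k (j + 1 + l + 1) - 1)
                (k (j + 1 + l + 1) - 1) : ℂ))) *
           (cmzv ((List.ofFn fun t : Fin j.val =>
              (k (j.val - t.val) + mm ⟨j.val - 1 - t.val, by have := t.isLt; have := j.isLt; omega⟩,
                (x (j.val - t.val))⁻¹))
              ++ [(k 0 + k (j.val + 1) - i - m - 1, (x 0)⁻¹)]) *
             (cmzv (List.ofFn fun t : Fin (r - (j.val + 1)) =>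
              (k (j.val + 2 + t.val) + mm ⟨j.val + 1 + t.val, by have := t.isLt; omega⟩,
                x (j.val + 2 + t.val))) * (-X * thatF i X)))) := by
    rw [Finset.mul_sum]
    refine Finset.sum_congr rfl fun j _ => ?_
    rw [Finset.mul_sum]
    refine Finset.sum_congr rfl fun i hi => ?_
    rw [Finset.mul_sum]
    refine Finset.sum_congr rfl fun m hm => ?_
    rw [Finset.mul_sum]
    refine Finset.sum_congr rfl fun mm _ => ?_
    rw [Finset.mem_range] at hi hm
    have s1 : (-1 : ℂ) ^ ((∑ t ∈ Finset.range (j.val + 1), k t)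
        + ∑ l ∈ Finset.univ.filter (fun l => j < l), mm l) =
        (∏ l ∈ range j, (-1 : ℂ) ^ k (l + 1)) * (-1) ^ k 0 *
          ∏ l ∈ range (r - (j + 1)), (-1 : ℂ) ^ extF r mm (j + 1 + l) := by
      rw [pow_add, Finset.sum_range_succ', pow_add, ← Finset.prod_pow_eq_pow_sum,
        ← Finset.prod_pow_eq_pow_sum, ← prod_gt_range r j (fun l => (-1 : ℂ) ^ extF r mm l)]
      simp only [extF_fin]
    have s2 : (∏ l ∈ Finset.univ.erase j,
        (Nat.choose (mm l + k (l.val + 1) - 1) (k (l.val + 1) - 1) : ℂ)) =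
        (∏ l ∈ range j, (Nat.choose (extF r mm l + k (l + 1) - 1) (k (l + 1) - 1) : ℂ)) *
        ∏ l ∈ range (r - (j + 1)), (Nat.choose (extF r mm (j + 1 + l) + k (j + 1 + l + 1) - 1)
                (k (j + 1 + l + 1) - 1) : ℂ) := by
      rw [← prod_erase_range r j
        (fun l => (Nat.choose (extF r mm l + k (l + 1) - 1) (k (l + 1) - 1) : ℂ))]
      simp only [extF_fin]
    have s3 : (-1 : ℂ) ^ k 0 = (-1 : ℂ) ^ (k (j + 1) - 1 - i - m) *
        (-1) ^ (k 0 + k (j + 1) - i - m - 1) := by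
      rw [show k 0 + k (j.val + 1) - i - m - 1 = k 0 + (k (j.val + 1) - 1 - i - m) by omega,
        pow_add, mul_left_comm, ← mul_pow]
      norm_num
    rw [s1, s2, s3, Finset.prod_mul_distrib, Finset.prod_mul_distrib, thatF]
    generalize ((-1 : ℂ) ^ i * tval1 (i + 1) X⁻¹ - X⁻¹ * tval1 (i + 1) X) = T
    generalize cmzv _ = u
    generalize cmzv _ = v
    have s4 : X⁻¹ * X = 1 := inv_mul_cancel₀ hX0
    generalize ((-1 : ℂ) ^ (k (j.val + 1) - 1 - i - m)) = a1
    generalize ((-1 : ℂ) ^ (k 0 + k (j.val + 1) - i - m - 1)) = a2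
    generalize (∏ l ∈ range j, (-1 : ℂ) ^ k (l + 1)) = a3
    generalize (∏ l ∈ range (r - (j + 1)), (-1 : ℂ) ^ extF r mm (j + 1 + l)) = a4
    generalize (∏ l ∈ range j, (Nat.choose (extF r mm l + k (l + 1) - 1) (k (l + 1) - 1) : ℂ)) = a5
    generalize (∏ l ∈ range (r - (j + 1)), (Nat.choose (extF r mm (j + 1 + l) +
      k (j + 1 + l + 1) - 1) (k (j + 1 + l + 1) - 1) : ℂ)) = a6
    generalize ((Nat.choose (k 0 + k (j + 1) - m - i - 2) (k 0 - 1) : ℕ) : ℂ) = a7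
    linear_combination -(a1 * a2 * a3 * a4 * a5 * a6 * a7 * T * u * v) * s4
  rw [eB, eC, eD]
  linear_combination X⁻¹ * hlim
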